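/- arXiv:1712.08660 — 5 statements merged into one kernel-verified Lean document; each statement's English description precedes it below -/
import Mathlib

section
/- Let F be an infinite field, q < n positive integers, and μ an n-vector whose entries generate a field extension of F of transcendence degree at least q. Then for almost all q×n matrices Q over F (i.e., all Q outside the zero set of some nonzero polynomial in the entries of Q), the q-vector Qμ has entries algebraically independent over F. -/
/-- The span of `1` and the entries of `v`. -/
def oneSpan (F : Type*) {A ι : Type*} [Field F] [CommRing A] [Algebra F A] (v : ι → A) :
    Submodule F A :=
  1 ⊔ Submodule.span F (Set.range v)

/-- `U` is a reduction of `W`, in the sense of Northcott and Rees, except that the containment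
`U ≤ W` is not part of the definition. -/
def IsReduction {F A : Type*} [Field F] [CommRing A] [Algebra F A] (U W : Submodule F A) : Prop :=
  ∃ d : ℕ, W ^ (d + 1) ≤ U * W ^ d

section Reduction

variable {F A ι : Type*} [Field F] [CommRing A] [Algebra F A]

open Submodule

lemma one_le_oneSpan (v : ι → A) : 1 ≤ oneSpan F v := le_sup_left

lemma mem_oneSpan (v : ι → A) (i : ι) : v i ∈ oneSpan F v :=
  le_sup_right (a := (1 : Submodule F A)) (subset_span ⟨i, rfl⟩)

lemma oneSpan_le {v : ι → A} {W : Submodule F A} (h1 : 1 ≤ W) (hv : ∀ i, v i ∈ W) :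
    oneSpan F v ≤ W :=
  sup_le h1 (span_le.2 (Set.range_subset_iff.2 hv))

lemma fg_oneSpan [Finite ι] (v : ι → A) : (oneSpan F v).FG := by
  refine Submodule.FG.sup ?_ (fg_span (Set.finite_range v))
  rw [Submodule.one_eq_span]
  exact fg_span_singleton 1

lemma IsReduction.refl (W : Submodule F A) : IsReduction W W := ⟨0, by simp⟩

lemma IsReduction.trans {U V W : Submodule F A} (hUV : IsReduction U V) (hVW : IsReduction V W)
    (hle : V ≤ W) : IsReduction U W := by
  obtain ⟨e, he⟩ := hUV
  obtain ⟨d, hd⟩ := hVW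
  have key : ∀ k, W ^ (d + k) ≤ V ^ k * W ^ d := by
    intro k
    induction k with
    | zero => simp
    | succ k ih =>
      calc W ^ (d + (k + 1)) = W * W ^ (d + k) := by ring
        _ ≤ W * (V ^ k * W ^ d) := mul_le_mul_right ih _
        _ = V ^ k * W ^ (d + 1) := by ring
        _ ≤ V ^ k * (V * W ^ d) := mul_le_mul_right hd _
        _ = V ^ (k + 1) * W ^ d := by ring
  refine ⟨e + d, ?_⟩
  calc W ^ (e + d + 1) = W ^ (d + (e + 1)) := by ring
    _ ≤ V ^ (e + 1) * W ^ d := key _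
    _ ≤ U * V ^ e * W ^ d := mul_le_mul_left he _
    _ ≤ U * W ^ e * W ^ d := mul_le_mul_left (mul_le_mul_right (pow_le_pow_left' hle e) _) _
    _ = U * W ^ (e + d) := by ring

/-- Replacing every factor `y i` of a monomial by `c i • z` changes it by an element of
`V * Y ^ (deg - 1)`. -/
lemma multiset_prod_sub_mem {V Y : Submodule F A} {y : ι → A} {c : ι → F}
    {z : A} (hy : ∀ i, y i ∈ Y) (hz : z ∈ Y) (hV : ∀ i, y i - c i • z ∈ V)
    (s : Multiset ι) (i : ι) :
    (((i ::ₘ s).map y).prod - ((i ::ₘ s).map c).prod • z ^ (s.card + 1)) ∈ V * Y ^ s.card := by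
  induction s using Multiset.induction_on generalizing i with
  | empty => simpa using hV i
  | cons j s ih =>
    have h1 := Submodule.mul_mem_mul (hy i) (ih j)
    rw [mul_left_comm, ← pow_succ'] at h1
    have h2 : (y i - c i • z) * (((j ::ₘ s).map c).prod • z ^ (s.card + 1)) ∈
        V * Y ^ (s.card + 1) :=
      Submodule.mul_mem_mul (hV i) (Submodule.smul_mem _ _ (Submodule.pow_mem_pow _ hz _))
    rw [Multiset.card_cons]
    convert add_mem h1 h2 using 1
    rw [Multiset.map_cons, Multiset.prod_cons, Multiset.map_cons c, Multiset.prod_cons]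
    simp only [Algebra.smul_def, map_mul]
    ring

lemma multiset_prod_mem_pow {Y : Submodule F A} {y : ι → A} (hy : ∀ i, y i ∈ Y)
    (s : Multiset ι) : (s.map y).prod ∈ Y ^ s.card := by
  induction s using Multiset.induction_on with
  | empty => simp [Submodule.one_le.1 le_rfl]
  | cons j s ih =>
    rw [Multiset.map_cons, Multiset.prod_cons, Multiset.card_cons, pow_succ']
    exact Submodule.mul_mem_mul (hy j) ih

lemma finsupp_prod_pow_eq {B : Type*} [CommMonoid B] (w : ι → B) (a : ι →₀ ℕ) :
    ∏ i ∈ a.support, w i ^ a i = (a.toMultiset.map w).prod := by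
  classical
  rw [Finsupp.toMultiset_map, Finsupp.prod_toMultiset, Finsupp.prod_mapDomain_index] <;>
    simp [pow_add, Finsupp.prod]

open MvPolynomial in
/-- Modulo `V * Y ^ e`, the value at `y` of a polynomial of degree `e + 1` is given by its leading
form. -/
lemma aeval_sub_mem {V Y : Submodule F A} (hV1 : 1 ≤ V) (hY1 : 1 ≤ Y) {y : ι → A} {c : ι → F}
    {z : A} (hy : ∀ i, y i ∈ Y) (hz : z ∈ Y) (hV : ∀ i, y i - c i • z ∈ V)
    (f : MvPolynomial ι F) {e : ℕ} (hf : f.totalDegree = e + 1) :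
    aeval y f - eval c (homogeneousComponent (e + 1) f) • z ^ (e + 1) ∈ V * Y ^ e := by
  rw [homogeneousComponent_apply, map_sum, Finset.sum_filter, aeval_def, eval₂_eq, Finset.sum_smul,
    ← Finset.sum_sub_distrib]
  refine Submodule.sum_mem _ fun a ha => ?_
  have hcard : a.toMultiset.card = a.degree := by
    rw [Finsupp.card_toMultiset, Finsupp.degree_apply]
    rfl
  rw [finsupp_prod_pow_eq]
  split_ifs with hdeg
  · rw [eval_monomial, Finsupp.prod, finsupp_prod_pow_eq, mul_smul, ← Algebra.smul_def, ← smul_sub]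
    refine Submodule.smul_mem _ _ ?_
    rw [hdeg] at hcard
    obtain ⟨i, hi⟩ := Multiset.card_pos_iff_exists_mem.1 (by rw [hcard]; exact e.succ_pos)
    obtain ⟨s, hs⟩ := Multiset.exists_cons_of_mem hi
    rw [hs, Multiset.card_cons, Nat.add_right_cancel_iff] at hcard
    rw [hs, ← hcard]
    exact multiset_prod_sub_mem hy hz hV s i
  · rw [zero_smul, sub_zero, ← Algebra.smul_def]
    refine Submodule.smul_mem _ _ ?_
    have hle : a.degree ≤ e := by
      have := le_totalDegree ha
      rw [hf] at this
      have h' : a.degree = a.sum fun _ k => k := by rw [Finsupp.degree_apply]; rfl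
      omega
    have h1 := pow_le_pow_right' hY1 (hcard ▸ hle) (multiset_prod_mem_pow hy a.toMultiset)
    simpa using Submodule.mul_mem_mul (Submodule.one_le.1 hV1) h1

/-- If `Y` is spanned by `V` and `z`, then so is `Y ^ (k + 1)` by `V * Y ^ k` and `z ^ (k + 1)`. -/
lemma pow_succ_le_sup {V Y : Submodule F A} {z : A} (hz : z ∈ Y) (hY : Y ≤ V ⊔ span F {z})
    (k : ℕ) : Y ^ (k + 1) ≤ V * Y ^ k ⊔ span F {z ^ (k + 1)} := by
  induction k with
  | zero => simpa using hY
  | succ k ih =>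
    calc Y ^ (k + 1 + 1) = Y * Y ^ (k + 1) := by ring
      _ ≤ Y * (V * Y ^ k ⊔ span F {z ^ (k + 1)}) := mul_le_mul_right ih _
      _ = V * Y ^ (k + 1) ⊔ Y * span F {z ^ (k + 1)} := by
        rw [Submodule.mul_sup, mul_left_comm, ← pow_succ']
      _ ≤ V * Y ^ (k + 1) ⊔ (V ⊔ span F {z}) * span F {z ^ (k + 1)} :=
        sup_le_sup_left (mul_le_mul_left hY _) _
      _ ≤ V * Y ^ (k + 1) ⊔ span F {z ^ (k + 1 + 1)} := by
        rw [Submodule.sup_mul, Submodule.span_mul_span, Set.singleton_mul_singleton, ← pow_succ']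
        refine sup_le le_sup_left (sup_le_sup_right (mul_le_mul_right ?_ _) _)
        exact (span_singleton_le_iff_mem _ _).2 (Submodule.pow_mem_pow _ hz _)

open MvPolynomial in
/-- One step of Noether normalization by linear forms. -/
lemma exists_isReduction_of_not_algebraicIndependent [Infinite F] [Nontrivial A] {m : ℕ}
    (y : Fin (m + 1) → A) (hy : ¬ AlgebraicIndependent F y) :
    ∃ v : Fin m → A, (∀ i, v i ∈ span F (Set.range y)) ∧
      IsReduction (oneSpan F v) (oneSpan F y) := by
  obtain ⟨f, hf0, hf⟩ : ∃ f : MvPolynomial (Fin (m + 1)) F, aeval y f = 0 ∧ f ≠ 0 := by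
    simpa [algebraicIndependent_iff] using hy
  obtain ⟨e, he⟩ : ∃ e, f.totalDegree = e + 1 := by
    refine Nat.exists_eq_succ_of_ne_zero fun h => hf ?_
    rw [totalDegree_eq_zero_iff_eq_C] at h
    rw [h, aeval_C, map_eq_zero_iff _ (algebraMap F A).injective] at hf0
    rw [h, hf0, map_zero]
  have hlead : homogeneousComponent (e + 1) f ≠ 0 := by
    obtain ⟨a, ha, hdeg⟩ := Finset.exists_mem_eq_sup f.support (support_nonempty.2 hf)
      fun a => a.sum fun _ k => k
    intro h
    have hcoeff := coeff_homogeneousComponent (e + 1) f a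
    have h' : a.degree = a.sum fun _ k => k := by rw [Finsupp.degree_apply]; rfl
    rw [h, if_pos (by rw [h', ← hdeg, ← he]; rfl), coeff_zero] at hcoeff
    exact mem_support_iff.1 ha hcoeff.symm
  obtain ⟨c, hc⟩ : ∃ c, eval c (homogeneousComponent (e + 1) f) ≠ 0 := by
    by_contra! h
    exact hlead (MvPolynomial.funext fun c => by rw [h, map_zero])
  obtain ⟨k, hk⟩ : ∃ k, c k ≠ 0 := by
    by_contra! h
    refine hc ?_
    rw [show c = 0 from funext h, eval_zero, constantCoeff_eq,
      coeff_homogeneousComponent, if_neg (by simp)]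
  set z : A := (c k)⁻¹ • y k
  set v : Fin m → A := fun i => y (k.succAbove i) - c (k.succAbove i) • z
  have hzy : z ∈ span F (Set.range y) := smul_mem _ _ (subset_span ⟨k, rfl⟩)
  have hv : ∀ i, v i ∈ span F (Set.range y) := fun i =>
    sub_mem (subset_span ⟨_, rfl⟩) (smul_mem _ _ hzy)
  have hspan : span F (Set.range y) ≤ oneSpan F y := le_sup_right
  have hV : ∀ i, y i - c i • z ∈ oneSpan F v := by
    intro i
    rcases Fin.eq_self_or_eq_succAbove k i with rfl | ⟨j, rfl⟩
    · simp [z, hk]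
    · exact mem_oneSpan v j
  have hY : oneSpan F y ≤ oneSpan F v ⊔ span F {z} := by
    refine oneSpan_le ((one_le_oneSpan v).trans le_sup_left) fun i => ?_
    rw [← sub_add_cancel (y i) (c i • z)]
    exact add_mem (mem_sup_left (hV i))
      (mem_sup_right (smul_mem _ _ (mem_span_singleton_self z)))
  refine ⟨v, hv, e, (pow_succ_le_sup (hspan hzy) hY e).trans (sup_le le_rfl ?_)⟩
  rw [span_singleton_le_iff_mem]
  have h := aeval_sub_mem (one_le_oneSpan v) (one_le_oneSpan y) (mem_oneSpan y) (hspan hzy) hV f he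
  rwa [hf0, zero_sub, neg_mem_iff, smul_mem_iff _ hc] at h

/-- Noether normalization by linear forms. -/
lemma exists_algebraicIndependent_isReduction [Infinite F] [Nontrivial A] {n : ℕ} (μ : Fin n → A) :
    ∃ (m : ℕ) (v : Fin m → A), AlgebraicIndependent F v ∧ (∀ i, v i ∈ span F (Set.range μ)) ∧
      IsReduction (oneSpan F v) (oneSpan F μ) := by
  induction n with
  | zero =>
    exact ⟨0, μ, algebraicIndependent_empty_type_iff.2 (algebraMap F A).injective,
      fun i => i.elim0, .refl _⟩
  | succ n ih =>
    by_cases hμ : AlgebraicIndependent F μ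
    · exact ⟨n + 1, μ, hμ, fun i => subset_span ⟨i, rfl⟩, .refl _⟩
    · obtain ⟨y, hy, hyμ⟩ := exists_isReduction_of_not_algebraicIndependent μ hμ
      obtain ⟨m, v, hv, hvy, hred⟩ := ih y
      refine ⟨m, v, hv, fun i => span_le.2 (Set.range_subset_iff.2 hy) (hvy i),
        hred.trans hyμ (oneSpan_le (one_le_oneSpan μ) fun i => ?_)⟩
      exact le_sup_right (a := (1 : Submodule F A)) (hy i)

open Algebra in
lemma IsReduction.isIntegral [Finite ι] [IsDomain A] {κ : Type*} {μ : ι → A} {y : κ → A}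
    (hred : IsReduction (oneSpan F y) (oneSpan F μ)) (hμ : adjoin F (Set.range μ) = ⊤) :
    Algebra.IsIntegral (adjoin F (Set.range y)) A := by
  obtain ⟨d, hd⟩ := hred
  set R := adjoin F (Set.range y)
  set N : Submodule R A := span R ((oneSpan F μ ^ d : Submodule F A) : Set A)
  have hN1 : (1 : A) ∈ N :=
    subset_span (Submodule.one_le.1 (one_le_pow_of_one_le' (one_le_oneSpan μ) d))
  have hNfg : N.FG := by
    obtain ⟨s, hs⟩ := (fg_oneSpan (F := F) μ).pow d
    refine ⟨s, ?_⟩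
    rw [← span_span_of_tower F R, hs]
  have hyR : oneSpan F y ≤ Subalgebra.toSubmodule R :=
    oneSpan_le (Submodule.one_le.2 R.one_mem) fun i => subset_adjoin ⟨i, rfl⟩
  have hpow : ∀ x ∈ oneSpan F μ ^ (d + 1), x ∈ N := by
    intro x hx
    refine Submodule.mul_induction_on (hd hx) (fun r hr w hw => ?_) fun _ _ => add_mem
    exact N.smul_mem (⟨r, hyR hr⟩ : R) (subset_span hw)
  have hmul : ∀ i, ∀ x ∈ N, μ i • x ∈ N := by
    intro i x hx
    induction hx using span_induction with
    | mem x hx =>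
      refine hpow _ ?_
      rw [pow_succ']
      exact Submodule.mul_mem_mul (mem_oneSpan μ i) hx
    | zero => simp
    | add _ _ _ _ h1 h2 => rw [smul_add]; exact add_mem h1 h2
    | smul r _ _ h => rw [smul_comm]; exact N.smul_mem r h
  have hint : ∀ i, IsIntegral R (μ i) := fun i =>
    isIntegral_of_smul_mem_submodule N (fun h => one_ne_zero ((mem_bot R).1 (h ▸ hN1))) hNfg _
      (hmul i)
  have htop : adjoin F (Set.range μ) ≤ (integralClosure R A).restrictScalars F :=
    adjoin_le (Set.range_subset_iff.2 hint)
  exact ⟨fun x => htop (hμ ▸ mem_top)⟩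

end Reduction

section Openness

open MvPolynomial in
/-- The determinant of an affine family of endomorphisms is a polynomial in the parameters. -/
lemma exists_mvPolynomial_eval_eq_det {F V σ : Type*} [Field F] [AddCommGroup V] [Module F V]
    [FiniteDimensional F V] [Fintype σ] (B : Module.End F V) (T : σ → Module.End F V) :
    ∃ ψ : MvPolynomial σ F, ∀ Q : σ → F, eval Q ψ = LinearMap.det (B + ∑ p, Q p • T p) := by
  classical
  let b := Module.finBasis F V
  refine ⟨((LinearMap.toMatrix b b B).map C +
    ∑ p, (X p : MvPolynomial σ F) • (LinearMap.toMatrix b b (T p)).map C).det, fun Q => ?_⟩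
  rw [← LinearMap.det_toMatrix b, RingHom.map_det]
  congr 1
  ext i j
  simp [Matrix.sum_apply]

variable {F A ι κ : Type*} [Field F] [CommRing A] [Algebra F A]

open Submodule MvPolynomial in
/-- Being a reduction is an open condition on the entries of a matrix. -/
lemma IsReduction.exists_mvPolynomial [Fintype ι] [Fintype κ] {μ : ι → A} {P : κ → ι → F}
    {v : κ → A} (hv : ∀ i, v i = ∑ j, P i j • μ j)
    (hred : IsReduction (oneSpan F v) (oneSpan F μ)) :
    ∃ ψ : MvPolynomial (κ × ι) F, eval (fun p => P p.1 p.2) ψ ≠ 0 ∧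
      ∀ Q : κ → ι → F, eval (fun p => Q p.1 p.2) ψ ≠ 0 →
        IsReduction (oneSpan F fun i => ∑ j, Q i j • μ j) (oneSpan F μ) := by
  obtain ⟨d, hd⟩ := hred
  set W := oneSpan F μ
  have hfin : ∀ k, FiniteDimensional F (W ^ k : Submodule F A) := fun k =>
    .of_fg ((fg_oneSpan μ).pow k)
  -- a linear choice of expansions of the elements of `W ^ (d + 1)`
  obtain ⟨U₀, U, hU⟩ : ∃ (U₀ : ↥(W ^ (d + 1)) →ₗ[F] ↥(W ^ d))
      (U : κ → ↥(W ^ (d + 1)) →ₗ[F] ↥(W ^ d)),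
      ∀ w : ↥(W ^ (d + 1)), (w : A) = U₀ w + ∑ i, v i * U i w := by
    let φ : ↥(W ^ d) × (κ → ↥(W ^ d)) →ₗ[F] A :=
      (W ^ d).subtype.coprod (∑ i, (LinearMap.mulLeft F (v i)).comp
        ((W ^ d).subtype.comp (LinearMap.proj i)))
    have hφ : ∀ x, φ x = x.1 + ∑ i, v i * x.2 i := fun x => by simp [φ]
    have hle : oneSpan F v * W ^ d ≤ LinearMap.range φ := by
      rw [oneSpan, Submodule.sup_mul, one_mul, sup_le_iff, Submodule.mul_le]
      refine ⟨fun w hw => ⟨(⟨w, hw⟩, 0), by simp [hφ]⟩, fun r hr w hw => ?_⟩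
      obtain ⟨a, rfl⟩ := (mem_span_range_iff_exists_fun F).1 hr
      refine ⟨(0, fun i => a i • ⟨w, hw⟩), ?_⟩
      simp [hφ, Finset.sum_mul]
    obtain ⟨g, hg⟩ := LinearMap.exists_rightInverse_of_surjective φ.rangeRestrict
      φ.range_rangeRestrict
    let h := g.comp (inclusion (hd.trans hle))
    refine ⟨(LinearMap.fst F _ _).comp h,
      fun i => (LinearMap.proj i).comp ((LinearMap.snd F _ _).comp h), fun w => ?_⟩
    have := congrArg Subtype.val (LinearMap.congr_fun hg (inclusion (hd.trans hle) w))
    exact this.symm.trans (hφ _)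
  let μW : ι → ↥(W ^ d) →ₗ[F] ↥(W ^ (d + 1)) := fun j =>
    ((LinearMap.mulLeft F (μ j)).comp (W ^ d).subtype).codRestrict _ fun w => by
      rw [pow_succ']
      exact Submodule.mul_mem_mul (mem_oneSpan μ j) w.2
  let T : κ × ι → Module.End F ↥(W ^ (d + 1)) := fun p => (μW p.2).comp (U p.1)
  have hT : ∀ p x, (T p x : A) = μ p.2 * U p.1 x := fun _ _ => rfl
  obtain ⟨ψ, hψ⟩ := exists_mvPolynomial_eval_eq_det (1 - ∑ p, P p.1 p.2 • T p) T
  have hone : 1 - ∑ p, P p.1 p.2 • T p + ∑ p, P p.1 p.2 • T p = 1 :=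
    LinearMap.ext fun x => by rw [LinearMap.add_apply, LinearMap.sub_apply, sub_add_cancel]
  refine ⟨ψ, ne_of_eq_of_ne ((hψ _).trans ((congrArg _ hone).trans (map_one _))) one_ne_zero,
    fun Q hQ => ⟨d, fun w hw => ?_⟩⟩
  rw [hψ, ← isUnit_iff_ne_zero, ← LinearMap.isUnit_iff_isUnit_det, Module.End.isUnit_iff] at hQ
  obtain ⟨x, hx⟩ := hQ.2 ⟨w, hw⟩
  have hw' : w = U₀ x + ∑ i, (∑ j, Q i j • μ j) * U i x := by
    have hx' := congrArg Subtype.val hx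
    simp only [LinearMap.add_apply, LinearMap.sub_apply, LinearMap.sum_apply,
      LinearMap.smul_apply, Module.End.one_apply, Submodule.coe_add, Submodule.coe_sub,
      Submodule.coe_sum, Submodule.coe_smul, hT, Fintype.sum_prod_type] at hx'
    rw [← hx', hU x]
    simp only [hv, Finset.sum_mul, smul_mul_assoc]
    abel
  rw [hw']
  refine add_mem ?_ (Submodule.sum_mem _ fun i _ => ?_)
  · simpa using Submodule.mul_mem_mul (Submodule.one_le.1 (one_le_oneSpan _)) (U₀ x).2
  · exact Submodule.mul_mem_mul (mem_oneSpan (fun i => ∑ j, Q i j • μ j) i) (U i x).2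

end Openness

/-- Let `F` be an infinite field, `q < n`, and `μ` an `n`-vector (with entries in an extension
`E` of `F`) having at least `q` degrees of freedom over `F` (i.e. some `q` of the generated
elements are algebraically independent over `F`). Then for almost all `q × n` matrices `Q`
over `F` — all `Q` outside the zero set of a nonzero polynomial `ψ` — the entries of the
`q`-vector `Qμ` are algebraically independent over `F`. -/
theorem generic_projection_of_vector {F E : Type*} [Field F] [Infinite F] [Field E]
    [Algebra F E] {n q : ℕ} (hq : 0 < q) (hqn : q < n) (μ : Fin n → E)
    (hfree : ∃ t : Finset (Fin n), t.card = q ∧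
      AlgebraicIndependent F (fun i : {x // x ∈ t} => μ i.1)) :
    ∃ ψ : MvPolynomial (Fin q × Fin n) F, ψ ≠ 0 ∧
      ∀ Q : Matrix (Fin q) (Fin n) F,
        MvPolynomial.eval (fun p => Q p.1 p.2) ψ ≠ 0 →
          AlgebraicIndependent F (fun i : Fin q => ∑ j, algebraMap F E (Q i j) * μ j) := by
  obtain ⟨t, htq, ht⟩ := hfree
  let A := Algebra.adjoin F (Set.range μ)
  have hinj : Function.Injective A.val := Subtype.val_injective
  let μA : Fin n → A := fun j => ⟨μ j, Algebra.subset_adjoin ⟨j, rfl⟩⟩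
  have hgen : Algebra.adjoin F (Set.range μA) = ⊤ := by
    apply Subalgebra.map_injective hinj
    rw [AlgHom.map_adjoin, Algebra.map_top, Subalgebra.range_val, ← Set.range_comp]
    rfl
  obtain ⟨m, v, hv, hvμ, hred⟩ := exists_algebraicIndependent_isReduction (F := F) μA
  simp only [Submodule.mem_span_range_iff_exists_fun] at hvμ
  choose P hP using hvμ
  have hqm : q ≤ m := by
    have := hred.isIntegral hgen
    have ht' : AlgebraicIndependent F (fun i : {x // x ∈ t} => μA i.1) :=
      (A.val.algebraicIndependent_iff hinj).1 ht
    have h1 := ht'.lift_cardinalMk_le_trdeg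
    have h2 := Cardinal.lift_le.2
      (Algebra.IsAlgebraic.trdeg_le_cardinalMk F (Set.range v))
    have h3 := h1.trans h2
    rw [Cardinal.mk_range_eq_of_injective hv.injective] at h3
    simpa [htq] using h3
  have hind : ∀ Q : Fin m → Fin n → F,
      IsReduction (oneSpan F fun i => ∑ j, Q i j • μA j) (oneSpan F μA) →
        AlgebraicIndependent F fun i => ∑ j, Q i j • μA j := by
    intro Q hQ
    have := hQ.isIntegral hgen
    exact (Algebra.IsAlgebraic.isTranscendenceBasis_of_lift_le_trdeg_of_finite F _
      (by simpa using hv.lift_cardinalMk_le_trdeg)).1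
  obtain ⟨ψ, hψP, hψ⟩ := hred.exists_mvPolynomial fun i => (hP i).symm
  -- the last `m - q` rows are kept fixed
  let extendRows : Matrix (Fin q) (Fin n) F → Fin m → Fin n → F :=
    fun Q i j => if h : i.1 < q then Q ⟨i.1, h⟩ j else P i j
  let θ : MvPolynomial (Fin q × Fin n) F := MvPolynomial.aeval
    (fun p : Fin m × Fin n => if h : p.1.1 < q then
      MvPolynomial.X (⟨p.1.1, h⟩, p.2) else MvPolynomial.C (P p.1 p.2)) ψ
  have hθ : ∀ Q : Matrix (Fin q) (Fin n) F, MvPolynomial.eval (fun p => Q p.1 p.2) θ =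
      MvPolynomial.eval (fun p => extendRows Q p.1 p.2) ψ := by
    intro Q
    have hhom : (MvPolynomial.aeval fun p => Q p.1 p.2).comp (MvPolynomial.aeval
        (fun p : Fin m × Fin n => if h : p.1.1 < q then
          MvPolynomial.X (⟨p.1.1, h⟩, p.2) else MvPolynomial.C (P p.1 p.2))) =
        MvPolynomial.aeval (R := F) fun p => extendRows Q p.1 p.2 := by
      ext p
      rw [AlgHom.comp_apply, MvPolynomial.aeval_X, MvPolynomial.aeval_X]
      dsimp only [extendRows]
      split_ifs <;> simp
    exact DFunLike.congr_fun hhom ψ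
  refine ⟨θ, fun h0 => hψP ?_, fun Q hQ => ?_⟩
  · have hPP : extendRows (fun i => P (Fin.castLE hqm i)) = P := by
      ext i j
      dsimp only [extendRows]
      split_ifs <;> rfl
    have := hθ fun i => P (Fin.castLE hqm i)
    rwa [h0, map_zero, hPP, eq_comm] at this
  · rw [hθ] at hQ
    have h := ((hind _ (hψ _ hQ)).map' hinj).comp (Fin.castLE hqm) (Fin.castLE_injective hqm)
    convert h using 1
    ext i
    simp [extendRows, μA, Algebra.smul_def]
end

section
/- Let F be an infinite field, d < n positive integers, and M an n×m matrix whose entries have at least mn − δ degrees of freedom over F. Then for almost all (n−d)×n matrices Q over F, at most δ/d columns of QM can be removed so that the remaining matrix is generic over F (its entries are algebraically independent over F). -/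
/-- `P` holds at every point outside the zero set of some nonzero polynomial. -/
def HoldsGenerically {σ F : Type*} [CommSemiring F] (P : (σ → F) → Prop) : Prop :=
  ∃ ψ : MvPolynomial σ F, ψ ≠ 0 ∧ ∀ x, MvPolynomial.eval x ψ ≠ 0 → P x

namespace HoldsGenerically

open MvPolynomial

variable {σ τ F : Type*} [Field F]

theorem mono {P P' : (σ → F) → Prop} (h : HoldsGenerically P) (hP : ∀ x, P x → P' x) :
    HoldsGenerically P' :=
  let ⟨ψ, hψ, H⟩ := h
  ⟨ψ, hψ, fun x hx => hP x (H x hx)⟩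

theorem of_forall {P : (σ → F) → Prop} (h : ∀ x, P x) : HoldsGenerically P :=
  ⟨1, one_ne_zero, fun x _ => h x⟩

theorem and {P P' : (σ → F) → Prop} (h : HoldsGenerically P) (h' : HoldsGenerically P') :
    HoldsGenerically fun x => P x ∧ P' x := by
  obtain ⟨ψ, hψ, H⟩ := h
  obtain ⟨ψ', hψ', H'⟩ := h'
  refine ⟨ψ * ψ', mul_ne_zero hψ hψ', fun x hx => ?_⟩
  rw [map_mul] at hx
  exact ⟨H x (left_ne_zero_of_mul hx), H' x (right_ne_zero_of_mul hx)⟩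

theorem forall_finite {ι : Type*} [Finite ι] {P : ι → (σ → F) → Prop}
    (h : ∀ i, HoldsGenerically (P i)) : HoldsGenerically fun x => ∀ i, P i x := by
  have := Fintype.ofFinite ι
  choose ψ hψ H using h
  refine ⟨∏ i, ψ i, Finset.prod_ne_zero_iff.mpr fun i _ => hψ i, fun x hx i => H i x ?_⟩
  rw [map_prod] at hx
  exact Finset.prod_ne_zero_iff.mp hx i (Finset.mem_univ i)

theorem exists_point [Infinite F] {P : (σ → F) → Prop} (h : HoldsGenerically P) :
    ∃ x, P x := by
  obtain ⟨ψ, hψ, H⟩ := h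
  by_contra! hP
  exact hψ (MvPolynomial.funext fun x => by
    rw [map_zero]
    by_contra hx
    exact hP x (H x hx))

/-- Pulling back along a polynomial map whose image is not contained in the bad locus. -/
theorem comp_polynomialMap {P : (σ → F) → Prop} {ψ : MvPolynomial σ F}
    (H : ∀ x, eval x ψ ≠ 0 → P x) (g : σ → MvPolynomial τ F) (y : τ → F)
    (hy : eval (fun i => eval y (g i)) ψ ≠ 0) :
    HoldsGenerically fun y : τ → F => P fun i => eval y (g i) := by
  have key : ∀ y : τ → F, eval y (aeval g ψ) = eval (fun i => eval y (g i)) ψ := fun y => by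
    rw [← MvPolynomial.coe_aeval_eq_eval, RingHom.coe_coe, comp_aeval_apply]
    simp [MvPolynomial.aeval_eq_eval]
  refine ⟨aeval g ψ, fun h0 => hy ?_, fun z hz => H _ (key z ▸ hz)⟩
  rw [← key, h0, map_zero]

theorem translate [Infinite F] {P : (σ → F) → Prop} (h : HoldsGenerically P) (v : σ → F) :
    HoldsGenerically fun x => P fun i => x i + v i := by
  obtain ⟨ψ, hψ, H⟩ := h
  obtain ⟨x, hx⟩ := exists_point (P := fun x => eval x ψ ≠ 0) ⟨ψ, hψ, fun _ => id⟩
  refine (comp_polynomialMap H (fun i => X i + C (v i)) (fun i => x i - v i)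
    (by simpa using hx)).mono fun y hy => ?_
  simpa only [map_add, eval_X, eval_C] using hy

theorem exists_extension [Infinite F] {P : (σ → F) → Prop} (h : HoldsGenerically P)
    {e : τ → σ} (he : e.Injective) :
    HoldsGenerically fun y : τ → F => ∃ x, x ∘ e = y ∧ P x := by
  classical
  obtain ⟨ψ, hψ, H⟩ := h
  obtain ⟨x, hx⟩ := exists_point (P := fun x => eval x ψ ≠ 0) ⟨ψ, hψ, fun _ => id⟩
  refine (comp_polynomialMap H (Function.extend e X fun i => C (x i)) (x ∘ e) ?_).mono
    fun y hy => ⟨_, ?_, hy⟩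
  · suffices (fun i => eval (x ∘ e) (Function.extend e X (fun i => C (x i)) i)) = x by rwa [this]
    ext i
    by_cases hi : ∃ j, e j = i
    · obtain ⟨j, rfl⟩ := hi
      simp [he.extend_apply]
    · simp [Function.extend_apply' _ _ _ hi]
  · ext j
    simp [he.extend_apply]

/-- A nonzero polynomial over an extension field is nonzero at generic points of the base field. -/
theorem eval_ne_zero {K : Type*} [Field K] [Algebra F K] {φ : MvPolynomial σ K} (hφ : φ ≠ 0) :
    HoldsGenerically fun x : σ → F => eval (fun i => algebraMap F K (x i)) φ ≠ 0 := by
  obtain ⟨d, hd⟩ := MvPolynomial.ne_zero_iff.mp hφ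
  obtain ⟨f, hf⟩ : ∃ f : Module.Dual F K, f (coeff d φ) ≠ 0 := by
    by_contra! h
    exact hd ((Module.forall_dual_apply_eq_zero_iff F _).mp h)
  refine ⟨∑ d ∈ φ.support, monomial d (f (coeff d φ)), fun h0 => hf ?_, fun x hx h0 => hx ?_⟩
  · have := congrArg (coeff d) h0
    classical
    simpa [coeff_sum, coeff_monomial, hd] using this
  · have := congrArg f h0
    rw [eval_eq, map_sum, map_zero] at this
    rw [map_sum, ← this]
    refine Finset.sum_congr rfl fun d _ => ?_
    rw [eval_monomial, Finsupp.prod, mul_comm (coeff d φ)]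
    simp_rw [← map_pow]
    rw [← map_prod, ← Algebra.smul_def, map_smul, smul_eq_mul, mul_comm]

end HoldsGenerically

namespace MvPolynomial

variable {τ R S : Type*} [CommRing R] [CommRing S] [Algebra R S]

/-- Restricted to the line `y + X • x`, a polynomial of degree at most `D` has as coefficient of
`X ^ D` the value at `x` of its homogeneous component of degree `D`. -/
theorem coeff_aeval_line (p : MvPolynomial τ R) {D : ℕ} (hp : p.totalDegree ≤ D) (y x : τ → S) :
    (aeval (fun i => Polynomial.C (y i) + Polynomial.C (x i) * Polynomial.X) p).coeff D =
      aeval x (homogeneousComponent D p) := by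
  have hlin : ∀ i, (Polynomial.C (y i) + Polynomial.C (x i) * Polynomial.X).natDegree ≤ 1 :=
    fun i => by compute_degree
  have hpow : ∀ i k, ((Polynomial.C (y i) + Polynomial.C (x i) * Polynomial.X) ^ k).natDegree ≤ k :=
    fun i k => (Polynomial.natDegree_pow_le_of_le k (hlin i)).trans (mul_one k).le
  have hprod : ∀ (d : τ → ℕ) (s : Finset τ),
      (∏ i ∈ s, (Polynomial.C (y i) + Polynomial.C (x i) * Polynomial.X) ^ d i).natDegree ≤
        ∑ i ∈ s, d i := fun d s =>
    (Polynomial.natDegree_prod_le _ _).trans (Finset.sum_le_sum fun i _ => hpow i (d i))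
  have hcoeff : ∀ (d : τ → ℕ) (s : Finset τ),
      (∏ i ∈ s, (Polynomial.C (y i) + Polynomial.C (x i) * Polynomial.X) ^ d i).coeff
        (∑ i ∈ s, d i) = ∏ i ∈ s, x i ^ d i := fun d s => by
    classical
    induction s using Finset.induction_on with
    | empty => simp
    | insert i s hi ih =>
      rw [Finset.prod_insert hi, Finset.sum_insert hi, Finset.prod_insert hi,
        Polynomial.coeff_mul_add_eq_of_natDegree_le (hpow i (d i)) (hprod d s), ih]
      congr 1
      have := Polynomial.coeff_pow_of_natDegree_le (m := d i) (hlin i)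
      rw [mul_one] at this
      simp [this]
  rw [homogeneousComponent_apply, map_sum, aeval_def, eval₂_eq, Polynomial.finsetSum_coeff,
    Finset.sum_filter]
  refine Finset.sum_congr rfl fun d hd => ?_
  have hdeg : d.degree ≤ D := (le_totalDegree hd).trans hp
  rw [IsScalarTower.algebraMap_apply R S (Polynomial S), Polynomial.algebraMap_eq,
    Polynomial.coeff_C_mul]
  split_ifs with h
  · rw [aeval_monomial, Finsupp.prod, ← h, Finsupp.degree_apply, hcoeff]
  · rw [Polynomial.coeff_eq_zero_of_natDegree_lt
      ((hprod d d.support).trans_lt (lt_of_le_of_ne hdeg h)), mul_zero]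

end MvPolynomial

section GenericProjection

variable {F K L : Type*} [Field F] [Field K] [Field L] [Algebra F K] [Algebra K L] [Algebra F L]
  [IsScalarTower F K L]

theorem MvPolynomial.exists_eval_algebraMap_ne_zero {R τ : Type*} [Infinite F] [CommRing R]
    [IsDomain R] [Algebra F R] {p : MvPolynomial τ R} (hp : p ≠ 0) :
    ∃ x : τ → F, eval (fun i => algebraMap F R (x i)) p ≠ 0 := by
  by_contra! h
  refine hp (funext_set (fun _ => Set.range (algebraMap F R))
    (fun _ => Set.infinite_range_of_injective (algebraMap F R).injective) fun y hy => ?_)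
  choose x hx using fun i => hy i (Set.mem_univ i)
  obtain rfl : (fun i => algebraMap F R (x i)) = y := _root_.funext hx
  rw [h x, map_zero]

theorem IntermediateField.isAlgebraic_of_adjoin_eq_top {s : Set L}
    (hs : IntermediateField.adjoin K s = ⊤) (B : Subalgebra K L)
    (h : ∀ a ∈ s, IsAlgebraic B a) : Algebra.IsAlgebraic B L := by
  refine ⟨fun z => ?_⟩
  have hz : z ∈ IntermediateField.adjoin K s := hs ▸ IntermediateField.mem_top
  induction hz using IntermediateField.adjoin_induction with
  | mem x hx => exact h x hx
  | algebraMap x =>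
    rw [IsScalarTower.algebraMap_apply K B L]
    exact isAlgebraic_algebraMap _
  | add x y _ _ hx hy => exact hx.add hy
  | inv x _ hx => exact hx.inv
  | mul x y _ _ hx hy => exact hx.mul hy

theorem IntermediateField.trdeg_le_of_adjoin_range_eq_top {n : ℕ} {a : Fin n → L}
    (ha : IntermediateField.adjoin K (Set.range a) = ⊤) : Algebra.trdeg K L ≤ n := by
  have : Algebra.IsAlgebraic (Algebra.adjoin K (Set.range a)) L :=
    isAlgebraic_of_adjoin_eq_top ha _ fun z hz =>
      isAlgebraic_algebraMap (⟨z, Algebra.subset_adjoin hz⟩ : Algebra.adjoin K (Set.range a))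
  have h := Cardinal.lift_le.{0}.mpr (Algebra.IsAlgebraic.trdeg_le_cardinalMk K (Set.range a))
  simpa using h.trans Cardinal.mk_range_le_lift

attribute [local instance] MvPolynomial.algebraMvPolynomial in
theorem MvPolynomial.trdeg_mvPolynomial_mvPolynomial {K L : Type*} [Field K] [Field L] [Algebra K L]
    (σ : Type) [Finite σ] :
    Algebra.trdeg (MvPolynomial σ K) (MvPolynomial σ L) = Algebra.trdeg K L := by
  have : FaithfulSMul (MvPolynomial σ K) (MvPolynomial σ L) :=
    (faithfulSMul_iff_algebraMap_injective _ _).mpr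
      (map_injective _ (algebraMap K L).injective)
  have : IsScalarTower K (MvPolynomial σ K) (MvPolynomial σ L) :=
    .of_algebraMap_eq fun x => (map_C (algebraMap K L) x).symm
  have h₁ := lift_trdeg_add_eq K (MvPolynomial σ K) (MvPolynomial σ L)
  have h₂ := lift_trdeg_add_eq K L (MvPolynomial σ L)
  simp only [trdeg_of_isDomain, Cardinal.lift_id] at h₁ h₂
  have := Fintype.ofFinite σ
  rw [← h₂, add_comm] at h₁
  simpa only [Cardinal.mk_fintype, Cardinal.lift_natCast, Cardinal.lift_add, Cardinal.add_nat_inj,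
    Cardinal.lift_inj] using h₁

namespace HoldsGenerically

variable [Infinite F]

open MvPolynomial in
attribute [local instance] MvPolynomial.algebraMvPolynomial in
/-- A coordinate of a point of transcendence degree at most `r` is algebraic over the subalgebra
generated by `r` generic linear combinations of the coordinates. -/
theorem isAlgebraic_coordinate {n r : ℕ} (a : Fin n → L) (hr : Algebra.trdeg K L ≤ r) (j : Fin n) :
    HoldsGenerically fun Q : Fin r × Fin n → F =>
      IsAlgebraic (Algebra.adjoin K (Set.range fun i => ∑ l, algebraMap F L (Q (i, l)) * a l))
        (a j) := by
  let g : Option (Fin r) → MvPolynomial (Fin r × Fin n) L :=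
    fun o => o.elim (C (a j)) fun i => ∑ l, X (i, l) * C (a l)
  obtain ⟨P, hgP, hP⟩ : ∃ P : MvPolynomial (Option (Fin r)) (MvPolynomial (Fin r × Fin n) K),
      aeval g P = 0 ∧ P ≠ 0 := by
    have hg : ¬ AlgebraicIndependent (MvPolynomial (Fin r × Fin n) K) g := fun hg => by
      have := hg.lift_cardinalMk_le_trdeg
      rw [trdeg_mvPolynomial_mvPolynomial] at this
      have := this.trans (Cardinal.lift_le.mpr hr)
      simp only [Cardinal.mk_fintype, Fintype.card_option, Fintype.card_fin, Cardinal.lift_natCast,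
        Nat.cast_le] at this
      omega
    rw [algebraicIndependent_iff] at hg
    push Not at hg
    exact hg
  set D := P.totalDegree
  have hG : homogeneousComponent D P ≠ 0 := fun h => hP <| by
    by_contra hP
    obtain ⟨d, hd, hdeg⟩ := Finset.exists_mem_eq_sup P.support (support_nonempty.mpr hP)
      fun d => d.degree
    have := congrArg (coeff d) h
    rw [coeff_homogeneousComponent, if_pos (show d.degree = D from hdeg.symm), coeff_zero] at this
    exact mem_support_iff.mp hd this
  obtain ⟨x, hx⟩ := exists_eval_algebraMap_ne_zero (F := F) (mul_ne_zero hG (X_ne_zero none))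
  rw [map_mul, eval_X] at hx
  have hx0 : algebraMap F L (x none) ≠ 0 := by
    rw [map_ne_zero]
    rintro h
    simp [h] at hx
  refine ((eval_ne_zero (F := F) (left_ne_zero_of_mul hx)).translate
    fun p => if p.2 = j then x (some p.1) / x none else 0).mono fun Q hQ => ?_
  set Q' : Fin r × Fin n → F := fun p => Q p + if p.2 = j then x (some p.1) / x none else 0
  set B := Algebra.adjoin K (Set.range fun i => ∑ l, algebraMap F L (Q (i, l)) * a l)
  let e : MvPolynomial (Fin r × Fin n) K →+* K := eval fun p => algebraMap F K (Q' p)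
  let p := map e P
  let y : Option (Fin r) → B := fun o => o.elim 0
    fun i => ⟨∑ l, algebraMap F L (Q (i, l)) * a l, Algebra.subset_adjoin ⟨i, rfl⟩⟩
  let q : Polynomial B := aeval (fun o => Polynomial.C (y o) +
    Polynomial.C (algebraMap K B (algebraMap F K (x o))) * Polynomial.X) p
  have hq : q ≠ 0 := fun hq => hQ <| by
    have h : q.coeff D = _ := coeff_aeval_line (D := D) p
      (Finset.sup_mono (support_map_subset e P)) y
      fun o => algebraMap K B (algebraMap F K (x o))
    have hmap : homogeneousComponent D p = map e (homogeneousComponent D P) := by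
      ext d
      simp only [coeff_homogeneousComponent, coeff_map, p]
      split_ifs <;> simp
    rw [hq, Polynomial.coeff_zero, hmap] at h
    have h' : algebraMap K B (e (eval (fun o => algebraMap F _ (x o))
        (homogeneousComponent D P))) = 0 := by
      rw [h, aeval_def, eval₂_map]
      change ((algebraMap K B).comp e) (eval _ _) = _
      rw [← eval₂_id, hom_eval₂, RingHom.comp_id]
      congr 1
      ext o
      simp [e, MvPolynomial.algebraMap_apply]
    rwa [map_eq_zero_iff _ (algebraMap K B).injective] at h'
  have hroot : Polynomial.aeval (a j / algebraMap F L (x none)) q = 0 := by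
    let φ : MvPolynomial (Fin r × Fin n) L →+* L := eval fun p => algebraMap F L (Q' p)
    have hφ : φ.comp (algebraMap (MvPolynomial (Fin r × Fin n) K) _) = (algebraMap K L).comp e := by
      rw [show algebraMap (MvPolynomial (Fin r × Fin n) K) (MvPolynomial (Fin r × Fin n) L) =
        map (algebraMap K L) from rfl]
      ext p
      · simp [φ, e]
      · simp [φ, e, ← IsScalarTower.algebraMap_apply]
    have hline : ∀ o, algebraMap B L (y o) + algebraMap F L (x o) *
        (a j / algebraMap F L (x none)) = φ (g o) := by
      rintro (_ | i)
      · simp [y, g, φ, mul_div_cancel₀ _ hx0]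
      · have : algebraMap B L (y (some i)) = ∑ l, algebraMap F L (Q (i, l)) * a l := rfl
        simp [this, g, φ, Q', add_mul, Finset.sum_add_distrib, ite_mul, apply_ite (algebraMap F L)]
        ring
    have h0 := congrArg φ hgP
    rw [aeval_def, hom_eval₂, hφ, map_zero, ← eval₂_map] at h0
    rw [← h0]
    change (Polynomial.aeval (R := B) (a j / algebraMap F L (x none))).toRingHom
      (eval₂ _ _ p) = _
    rw [hom_eval₂]
    congr 1
    · ext c
      simp
    · ext o
      simp [← hline, ← IsScalarTower.algebraMap_apply]
  have hw : IsAlgebraic B (a j / algebraMap F L (x none)) := ⟨q, hq, hroot⟩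
  have := (isAlgebraic_algebraMap (A := L) (algebraMap K B (algebraMap F K (x none)))).mul hw
  rwa [← IsScalarTower.algebraMap_apply K B L, ← IsScalarTower.algebraMap_apply F K L,
    mul_div_cancel₀ _ hx0] at this

/-- If the coordinates of a point have transcendence degree at least `k`, then `k` generic linear
combinations of them are algebraically independent. -/
theorem algebraicIndependent_of_le_trdeg {n k : ℕ} (a : Fin n → L)
    (ha : IntermediateField.adjoin K (Set.range a) = ⊤) (hk : k ≤ Algebra.trdeg K L) :
    HoldsGenerically fun Q : Fin k × Fin n → F =>
      AlgebraicIndependent K fun i => ∑ l, algebraMap F L (Q (i, l)) * a l := by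
  obtain ⟨r, hr⟩ := Cardinal.lt_aleph0.mp <|
    (IntermediateField.trdeg_le_of_adjoin_range_eq_top ha).trans_lt Cardinal.natCast_lt_aleph0
  have hkr : k ≤ r := by rwa [hr, Nat.cast_le] at hk
  refine ((forall_finite fun j => isAlgebraic_coordinate (F := F) a hr.le j).exists_extension
    (e := Prod.map (Fin.castLE hkr) id)
    ((Fin.castLE_injective hkr).prodMap Function.injective_id)).mono ?_
  rintro _ ⟨Q, rfl, hQ⟩
  have := IntermediateField.isAlgebraic_of_adjoin_eq_top ha _ (Set.forall_mem_range.mpr hQ)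
  have := (Algebra.IsAlgebraic.isTranscendenceBasis_of_lift_le_trdeg_of_finite K
    (x := fun i : Fin r => ∑ l, algebraMap F L (Q (i, l)) * a l) (by simp [hr])).1
  exact this.comp _ (Fin.castLE_injective hkr)

end HoldsGenerically


theorem IntermediateField.adjoin_range_codRestrict {K E ι : Type*} [Field K] [Field E] [Algebra K E]
    (a : ι → E) :
    IntermediateField.adjoin K (Set.range fun i =>
      (⟨a i, IntermediateField.subset_adjoin K _ ⟨i, rfl⟩⟩ :
        IntermediateField.adjoin K (Set.range a))) = ⊤ := by
  apply IntermediateField.lift_injective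
  rw [IntermediateField.lift_adjoin, IntermediateField.lift_top, ← Set.range_comp]
  rfl

theorem IntermediateField.trdeg_adjoin_union {K E : Type*} [Field K] [Field E] [Algebra K E]
    (s t : Set E) :
    Algebra.trdeg K (adjoin K (s ∪ t)) =
      Algebra.trdeg K (adjoin K s) + Algebra.trdeg (adjoin K s) (adjoin (adjoin K s) t) := by
  rw [← adjoin_adjoin_left]
  generalize adjoin (adjoin K s) t = L
  have : FaithfulSMul (adjoin K s) L :=
    (faithfulSMul_iff_algebraMap_injective _ _).mpr (algebraMap (adjoin K s) L).injective
  exact (trdeg_add_eq K (adjoin K s) (A := L)).symm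

/-- If all columns of `v` in `S` but those in `bad` are independent over `K'` and column `j` has
entries in `K'` independent over `K`, then column `j` may be added to `S`. -/
theorem AlgebraicIndependent.of_insert_column {K K' E κ ι : Type*} [Field K] [Field K'] [Field E]
    [Algebra K K'] [Algebra K' E] [Algebra K E] [IsScalarTower K K' E] [DecidableEq ι]
    {v : κ × ι → E} {S bad : Finset ι} {j : ι} {x : κ → K'}
    (hv : AlgebraicIndependent K' fun p : {p : κ × ι // p.2 ∈ S ∧ p.2 ∉ bad} => v p)
    (hx : AlgebraicIndependent K x) (hxv : ∀ i, algebraMap K' E (x i) = v (i, j)) :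
    AlgebraicIndependent K fun p : {p : κ × ι // p.2 ∈ insert j S ∧ p.2 ∉ bad} => v p := by
  let e : {p : κ × ι // p.2 ∈ insert j S ∧ p.2 ∉ bad} →
      {p : κ × ι // p.2 ∈ S ∧ p.2 ∉ bad} ⊕ κ := fun p =>
    if h : p.1.2 = j then .inr p.1.1
    else .inl ⟨p.1, (Finset.mem_insert.mp p.2.1).resolve_left h, p.2.2⟩
  have he : Sum.elim (fun p : {p : κ × ι // p.2 ∈ S ∧ p.2 ∉ bad} => p.1) (fun i => (i, j)) ∘ e =
      Subtype.val := by
    ext1 p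
    by_cases h : p.1.2 = j
    · simp [e, h, Prod.ext_iff]
    · simp [e, h]
  have hinj : e.Injective := .of_comp (he ▸ Subtype.val_injective)
  convert (hx.sumElim_comp hv).comp e hinj using 1
  change v ∘ Subtype.val = _
  rw [← he, ← Function.comp_assoc, Sum.comp_elim]
  congr 2
  exact funext fun i => (hxv i).symm

/-- Splitting off one column at a time: a generic `(n - d) × n` matrix keeps independent all columns
but a set `bad`, and each bad column has cost at least `d` degrees of freedom. -/
theorem HoldsGenerically.exists_bad_columns.{u, v, w} {F : Type u} {E : Type v} {ι : Type w}
    [Field F] [Infinite F] [Field E] [Algebra F E] [DecidableEq ι] {n d : ℕ} (hdn : d ≤ n)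
    (M : Fin n → ι → E) (S : Finset ι) (K : Type v) [Field K] [Algebra F K] [Algebra K E]
    [IsScalarTower F K E] :
    ∃ bad : Finset ι,
      Algebra.trdeg K (IntermediateField.adjoin K (⋃ j ∈ S, Set.range fun i => M i j)) +
        (bad.card * d : ℕ) ≤ (S.card * n : ℕ) ∧
      HoldsGenerically fun Q : Fin (n - d) × Fin n → F =>
        AlgebraicIndependent K fun p : {p : Fin (n - d) × ι // p.2 ∈ S ∧ p.2 ∉ bad} =>
          ∑ l, algebraMap F E (Q (p.1.1, l)) * M l p.1.2 := by
  induction S using Finset.induction_on generalizing K with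
  | empty =>
    refine ⟨∅, ?_, .of_forall fun Q => ?_⟩
    · have : Algebra.trdeg K (IntermediateField.adjoin K
          (⋃ j ∈ (∅ : Finset ι), Set.range fun i => M i j)) = 0 := by
        rw [show (⋃ j ∈ (∅ : Finset ι), Set.range fun i => M i j) = ∅ by simp,
          IntermediateField.adjoin_empty]
        exact trdeg_eq_zero
      simp [this]
    · have : IsEmpty {p : Fin (n - d) × ι // p.2 ∈ (∅ : Finset ι) ∧ p.2 ∉ (∅ : Finset ι)} :=
        ⟨fun p => by simpa using p.2⟩
      exact (algebraicIndependent_empty_type_iff ..).mpr (algebraMap K E).injective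
  | insert j S hj ih =>
    let K' := IntermediateField.adjoin K (Set.range fun i => M i j)
    let a : Fin n → K' := fun i => ⟨M i j, IntermediateField.subset_adjoin K _ ⟨i, rfl⟩⟩
    have ha : IntermediateField.adjoin K (Set.range a) = ⊤ :=
      IntermediateField.adjoin_range_codRestrict fun i => M i j
    have : IsScalarTower F K' E := .of_algebraMap_eq fun x => rfl
    obtain ⟨bad, hbad, hind⟩ := ih K'
    set L := IntermediateField.adjoin K' (⋃ j ∈ S, Set.range fun i => M i j)
    have htr : Algebra.trdeg K (IntermediateField.adjoin K
        (⋃ j' ∈ insert j S, Set.range fun i => M i j')) =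
          Algebra.trdeg K K' + Algebra.trdeg K' L := by
      rw [Finset.set_biUnion_insert, IntermediateField.trdeg_adjoin_union]
    have hle := IntermediateField.trdeg_le_of_adjoin_range_eq_top ha
    obtain ⟨r, hr⟩ := Cardinal.lt_aleph0.mp (hle.trans_lt Cardinal.natCast_lt_aleph0)
    obtain ⟨r', hr'⟩ := Cardinal.lt_aleph0.mp
      ((le_self_add.trans hbad).trans_lt Cardinal.natCast_lt_aleph0)
    rw [hr, Nat.cast_le] at hle
    rw [hr'] at hbad
    rw [htr, hr, hr', Finset.card_insert_of_notMem hj]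
    norm_cast at hbad ⊢
    by_cases h : n - d ≤ r
    · refine ⟨bad, by linarith, (hind.and (algebraicIndependent_of_le_trdeg a ha
        (by rwa [hr, Nat.cast_le]))).mono fun Q hQ => ?_⟩
      exact hQ.1.of_insert_column (v := fun p => ∑ l, algebraMap F E (Q (p.1, l)) * M l p.2) hQ.2
        fun i => by simp [a, IsScalarTower.algebraMap_apply F K' E]
    · refine ⟨insert j bad, ?_, hind.mono fun Q hQ => ?_⟩
      · have := Nat.mul_le_mul_right d (Finset.card_insert_le j bad)
        rw [add_mul] at this ⊢
        omega
      · exact (hQ.restrictScalars (algebraMap K K').injective).comp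
          (fun p : {p : Fin (n - d) × ι // p.2 ∈ insert j S ∧ p.2 ∉ insert j bad} => ⟨p.1,
            (Finset.mem_insert.mp p.2.1).resolve_left fun h =>
              p.2.2 (Finset.mem_insert.mpr (.inl h)),
            fun h => p.2.2 (Finset.mem_insert_of_mem h)⟩)
          fun p q h => Subtype.ext (congrArg (fun z => z.1) h)

end GenericProjection

/-- Let `F` be an infinite field, `d < n`, and `M` an `n × m` matrix (entries in an extension
`E` of `F`) having at least `mn − δ` degrees of freedom over `F`. Then for almost all
`(n−d) × n` matrices `Q` over `F`, one can remove at most `δ/d` columns of `QM` so that the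
entries of the remaining matrix are algebraically independent over `F`. -/
theorem generic_projection_of_matrix {F E : Type*} [Field F] [Infinite F] [Field E]
    [Algebra F E] {n m d δ : ℕ} (hd : 0 < d) (hdn : d < n)
    (M : Fin n → Fin m → E)
    (hfree : ∃ t : Finset (Fin n × Fin m), t.card = m * n - δ ∧
      AlgebraicIndependent F (fun p : {x // x ∈ t} => M p.1.1 p.1.2)) :
    ∃ ψ : MvPolynomial (Fin (n - d) × Fin n) F, ψ ≠ 0 ∧
      ∀ Q : Matrix (Fin (n - d)) (Fin n) F,
        MvPolynomial.eval (fun p => Q p.1 p.2) ψ ≠ 0 →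
          ∃ bad : Finset (Fin m), ((bad.card : ℚ) ≤ (δ : ℚ) / (d : ℚ)) ∧
            AlgebraicIndependent F
              (fun p : {p : Fin (n - d) × Fin m // p.2 ∉ bad} =>
                ∑ j, algebraMap F E (Q p.1.1 j) * M j p.1.2) := by
  obtain ⟨t, ht, hind⟩ := hfree
  let K : IntermediateField F E := ⊥
  obtain ⟨bad, hbad, ψ, hψ, H⟩ :=
    HoldsGenerically.exists_bad_columns (F := F) hdn.le M Finset.univ K
  refine ⟨ψ, hψ, fun Q hQ => ⟨bad, ?_, ?_⟩⟩
  · have hK : AlgebraicIndependent K fun p : {x // x ∈ t} => M p.1.1 p.1.2 :=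
      hind.ringHom_of_comp_eq (f := algebraMap F K) (g := RingHom.id E)
        (fun x => IntermediateField.mem_bot.mp x.2 |>.imp fun y hy => Subtype.ext hy)
        Function.injective_id rfl
    let L := IntermediateField.adjoin K (⋃ j ∈ Finset.univ, Set.range fun i => M i j)
    let x : {x // x ∈ t} → L := fun p => ⟨M p.1.1 p.1.2, IntermediateField.subset_adjoin K _ <|
      Set.mem_biUnion (Finset.mem_univ p.1.2) ⟨p.1.1, rfl⟩⟩
    have hx : AlgebraicIndependent K x := .of_comp L.val hK
    have hle := hx.lift_cardinalMk_le_trdeg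
    simp only [Cardinal.mk_fintype, Fintype.card_coe, ht, Cardinal.lift_natCast,
      Cardinal.lift_id'] at hle
    have hsum := (add_le_add_left hle _).trans hbad
    rw [← Nat.cast_add, Nat.cast_le, Finset.card_univ, Fintype.card_fin] at hsum
    rw [le_div_iff₀ (by exact_mod_cast hd)]
    norm_cast
    omega
  · have hF : AlgebraicIndependent F _ :=
      (H (fun p => Q p.1 p.2) hQ).restrictScalars (algebraMap F K).injective
    exact hF.comp (fun p : {p : Fin (n - d) × Fin m // p.2 ∉ bad} => ⟨p.1, Finset.mem_univ _, p.2⟩)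
      fun p q h => Subtype.ext (congrArg (fun z => z.1) h)
end

section
/- If a tensor Φ of format n×n×n over a field extension of K has transcendence degree (of the field generated by its entries) at least τ over K, then rank_K'(Φ) ≥ τ/(3n) for any field K' containing the entries of Φ and K. -/
theorem AlgebraicIndependent.card_le_of_mem_adjoin_range {R A ι σ : Type*} [CommRing R] [IsDomain R]
    [CommRing A] [Algebra R A] [Fintype ι] [Fintype σ] {x : ι → A}
    (hx : AlgebraicIndependent R x) (y : σ → A)
    (hmem : ∀ i, x i ∈ Algebra.adjoin R (Set.range y)) :
    Fintype.card ι ≤ Fintype.card σ := by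
  simp only [Algebra.adjoin_range_eq_range_aeval, AlgHom.mem_range] at hmem
  choose p hp using hmem
  have hp' : AlgebraicIndependent R p := .of_comp (MvPolynomial.aeval y) <| by
    simpa only [Function.comp_def, hp] using hx
  simpa using hp'.lift_cardinalMk_le_trdeg

theorem exists_sum_decomposable {F : Type*} [Semiring F] {n : ℕ} (Φ : Fin n → Fin n → Fin n → F) :
    ∃ r, ∃ a b c : Fin r → Fin n → F, ∀ i j k, Φ i j k = ∑ t, a t i * b t j * c t k := by
  let e := Fintype.equivFin (Fin n × Fin n × Fin n)
  refine ⟨_, fun t i => if (e.symm t).1 = i then Φ i (e.symm t).2.1 (e.symm t).2.2 else 0,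
    fun t j => if (e.symm t).2.1 = j then 1 else 0,
    fun t k => if (e.symm t).2.2 = k then 1 else 0, fun i j k => ?_⟩
  rw [e.symm.sum_comp (fun p : Fin n × Fin n × Fin n =>
    (if p.1 = i then Φ i p.2.1 p.2.2 else 0) * (if p.2.1 = j then 1 else 0) *
      (if p.2.2 = k then 1 else 0))]
  simp [Fintype.sum_prod_type]


/-- If the entries of an `n×n×n` tensor `Φ` generate a field of transcendence degree at least
`τ` over `K` (i.e. some `τ` of its entries are algebraically independent over `K`), then for
any field `K'` containing `K` and the entries of `Φ`, the rank of `Φ` over `K'` is at least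
`τ/(3n)`, i.e. `τ ≤ 3n · rank_{K'}(Φ)`. -/
theorem trank_ge_freedom_div {K E : Type*} [Field K] [Field E] [Algebra K E]
    {n τ : ℕ} (Φ : Fin n → Fin n → Fin n → E)
    (K' : Subfield E) (hK : Set.range (algebraMap K E) ⊆ K')
    (hent : ∀ i j k, Φ i j k ∈ K')
    (hfree : ∃ t : Finset (Fin n × Fin n × Fin n), t.card = τ ∧
      AlgebraicIndependent K (fun p : {x // x ∈ t} => Φ p.1.1 p.1.2.1 p.1.2.2)) :
    τ ≤ 3 * n * sInf {r | ∃ a b c : Fin r → Fin n → K',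
      ∀ i j k, Φ i j k = ∑ t, (a t i : E) * (b t j : E) * (c t k : E)} := by
  have hne : {r | ∃ a b c : Fin r → Fin n → K',
      ∀ i j k, Φ i j k = ∑ t, (a t i : E) * (b t j : E) * (c t k : E)}.Nonempty := by
    obtain ⟨r, a, b, c, h⟩ := exists_sum_decomposable
      fun i j k => (⟨Φ i j k, hent i j k⟩ : K')
    refine ⟨r, a, b, c, fun i j k => ?_⟩
    simpa using congrArg (Subtype.val) (h i j k)
  obtain ⟨a, b, c, h⟩ := Nat.sInf_mem hne
  obtain ⟨t, rfl, ht⟩ := hfree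
  generalize sInf {r | ∃ a b c : Fin r → Fin n → K',
    ∀ i j k, Φ i j k = ∑ t, (a t i : E) * (b t j : E) * (c t k : E)} = r at a b c h ⊢
  let y : Fin 3 × Fin n × Fin r → E := fun p => ![a p.2.2 p.2.1, b p.2.2 p.2.1, c p.2.2 p.2.1] p.1
  have hy (p) : y p ∈ Algebra.adjoin K (Set.range y) := Algebra.subset_adjoin ⟨p, rfl⟩
  have hcard := ht.card_le_of_mem_adjoin_range y fun p => by
    rw [h]
    exact sum_mem fun s _ => mul_mem (mul_mem (hy (0, p.1.1, s)) (hy (1, p.1.2.1, s)))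
      (hy (2, p.1.2.2, s))
  simpa [mul_assoc] using hcard
end

section
/- Strassen's direct sum conjecture is false: for any infinite field F there exist tensors T1 and T2 over F (with disjoint index sets) such that rank_F(T1 ⊕ T2) < rank_{F̄}(T1) + rank_{F̄}(T2), where F̄ is the algebraic closure of F; in particular rank_F(T1 ⊕ T2) < rank_F(T1) + rank_F(T2). -/
/-- The rank of a tensor `T : I → J → K → F`: the least `r` such that `T` is a sum of `r`
decomposable tensors. -/
noncomputable def trank (F : Type*) [Field F] {I J K : Type*} (T : I → J → K → F) : ℕ :=
  sInf {r | ∃ a : Fin r → I → F, ∃ b : Fin r → J → F, ∃ c : Fin r → K → F,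
    ∀ i j k, T i j k = ∑ t, a t i * b t j * c t k}

/-- Direct sum of two tensors on disjoint index sets. -/
def dsum {F I I' J J' K K' : Type*} [Zero F] (T1 : I → J → K → F) (T2 : I' → J' → K' → F) :
    I ⊕ I' → J ⊕ J' → K ⊕ K' → F
  | Sum.inl i, Sum.inl j, Sum.inl k => T1 i j k
  | Sum.inr i, Sum.inr j, Sum.inr k => T2 i j k
  | _, _, _ => 0

namespace StrassenDirectSum

section Rank

variable {k : Type*} [Field k] {I J L : Type*}

/-- `T` is a sum of `r` decomposable tensors. -/
def RankLE (r : ℕ) (T : I → J → L → k) : Prop :=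
  ∃ a : Fin r → I → k, ∃ b : Fin r → J → k, ∃ c : Fin r → L → k,
    ∀ i j l, T i j l = ∑ t, a t i * b t j * c t l

theorem RankLE.of_fintype {ι : Type*} [Fintype ι] {r : ℕ} (h : Fintype.card ι ≤ r)
    {T : I → J → L → k} (a : ι → I → k) (b : ι → J → k) (c : ι → L → k)
    (hT : ∀ i j l, T i j l = ∑ t, a t i * b t j * c t l) : RankLE r T := by
  classical
  obtain ⟨f⟩ : Nonempty (ι ↪ Fin r) :=
    Function.Embedding.nonempty_of_card_le (by simpa using h)
  refine ⟨Function.extend f a 0, Function.extend f b 0, Function.extend f c 0, fun i j l => ?_⟩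
  rw [hT, ← Finset.sum_subset (Finset.subset_univ (Finset.univ.map f)), Finset.sum_map]
  · simp [f.injective.extend_apply]
  · intro t _ ht
    have : ¬ ∃ x, f x = t := by simpa using ht
    simp [Function.extend_apply' _ _ _ this]

theorem RankLE.mono {r s : ℕ} (h : r ≤ s) {T : I → J → L → k} (hT : RankLE r T) :
    RankLE s T := by
  obtain ⟨a, b, c, hT⟩ := hT
  exact .of_fintype (by simpa using h) a b c hT

theorem RankLE.comp {I' J' L' : Type*} {r : ℕ} {T : I → J → L → k} (hT : RankLE r T)
    (f : I' → I) (g : J' → J) (h : L' → L) : RankLE r fun i j l => T (f i) (g j) (h l) := by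
  obtain ⟨a, b, c, hT⟩ := hT
  exact ⟨fun t i => a t (f i), fun t j => b t (g j), fun t l => c t (h l), fun i j l => hT _ _ _⟩

theorem RankLE.map {k' : Type*} [Field k'] (φ : k →+* k') {r : ℕ} {T : I → J → L → k}
    (hT : RankLE r T) : RankLE r fun i j l => φ (T i j l) := by
  obtain ⟨a, b, c, hT⟩ := hT
  exact ⟨fun t i => φ (a t i), fun t j => φ (b t j), fun t l => φ (c t l),
    fun i j l => by simp [hT]⟩

theorem trank_le {r : ℕ} {T : I → J → L → k} (hT : RankLE r T) : trank k T ≤ r :=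
  Nat.sInf_le hT

theorem exists_rankLE [Finite I] [Finite J] (T : I → J → L → k) : ∃ r, RankLE r T := by
  classical
  cases nonempty_fintype I
  cases nonempty_fintype J
  refine ⟨_, .of_fintype (ι := I × J) le_rfl (fun t i => if t.1 = i then 1 else 0)
    (fun t j => if t.2 = j then 1 else 0) (fun t l => T t.1 t.2 l) fun i j l => ?_⟩
  simp [Fintype.sum_prod_type]

theorem rankLE_trank [Finite I] [Finite J] (T : I → J → L → k) : RankLE (trank k T) T :=
  Nat.sInf_mem (s := {r | RankLE r T}) (exists_rankLE T)

/-- Cyclic rotation of the three factors of a tensor. -/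
def rot (T : I → J → L → k) : J → L → I → k := fun j l i => T i j l

theorem RankLE.rot {r : ℕ} {T : I → J → L → k} (hT : RankLE r T) :
    RankLE r (StrassenDirectSum.rot T) := by
  obtain ⟨a, b, c, hT⟩ := hT
  exact ⟨b, c, a, fun j l i => by simp [StrassenDirectSum.rot, hT, mul_comm, mul_left_comm]⟩

theorem rot_dsum {I' J' L' : Type*} (T : I → J → L → k) (S : I' → J' → L' → k) :
    rot (dsum T S) = dsum (rot T) (rot S) := by
  funext j l i
  rcases i with i | i <;> rcases j with j | j <;> rcases l with l | l <;> rfl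

/-- Extension of a matrix by zero. -/
def pad {J' L' : Type*} (w : J → L → k) : J ⊕ J' → L ⊕ L' → k :=
  Sum.elim (fun j => Sum.elim (w j) 0) 0

section

variable {J' L' : Type*} (w : J → L → k)

@[simp] theorem pad_inl_inl (j : J) (l : L) :
    pad (J' := J') (L' := L') w (.inl j) (.inl l) = w j l := rfl

@[simp] theorem pad_inr_left (j : J') (l : L ⊕ L') : pad w (.inr j) l = 0 := rfl

@[simp] theorem pad_inr_right (j : J ⊕ J') (l : L') : pad w j (.inr l) = 0 := by
  cases j <;> rfl

@[simp] theorem pad_zero : pad (J' := J') (L' := L') (0 : J → L → k) = 0 := by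
  funext j l
  rcases j with j | j <;> rcases l with l | l <;> rfl

theorem map_pad {k' : Type*} [Field k'] (φ : k →+* k') (j : J ⊕ J') (l : L ⊕ L') :
    φ (pad w j l) = pad (fun j l => φ (w j l)) j l := by
  rcases j with j | j <;> rcases l with l | l <;> simp

end

variable {P Q R : Type*} [Fintype P] [Fintype Q] [Fintype R]

/-- `T` becomes a sum of `r` decomposable tensors after adding tensors `x ⊗ w`, for the matrices
`w` in the three given families and arbitrary vectors `x` in the remaining factor. -/
def ModRankLE (T : I → J → L → k) (U : P → J → L → k) (V : Q → L → I → k) (W : R → I → J → k)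
    (r : ℕ) : Prop :=
  ∃ (x : P → I → k) (y : Q → J → k) (z : R → L → k), RankLE r fun i j l =>
    T i j l + ∑ p, x p i * U p j l + ∑ p, y p j * V p l i + ∑ p, z p l * W p i j

theorem ModRankLE.rot {T : I → J → L → k} {U : P → J → L → k} {V : Q → L → I → k}
    {W : R → I → J → k} {r : ℕ} (h : ModRankLE T U V W r) :
    ModRankLE (StrassenDirectSum.rot T) V W U r := by
  obtain ⟨x, y, z, h⟩ := h
  refine ⟨y, z, x, ?_⟩
  convert h.rot using 4
  simp only [StrassenDirectSum.rot]
  ring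

/-- Modulo the given families of matrices, the rank of `T ⊕ S` over `F` exceeds that of `T` over
`K` by at most `g`. -/
def SmallGap (F K : Type*) [Field F] [Field K] [Algebra F K] {I J L I' J' L' : Type*}
    (T : I → J → L → F) (S : I' → J' → L' → F)
    (U : P → J → L → F) (V : Q → L → I → F) (W : R → I → J → F) (g : ℕ) : Prop :=
  ∃ ρ, ModRankLE (dsum T S) (fun p => pad (U p)) (fun p => pad (V p)) (fun p => pad (W p)) ρ ∧
    ∀ r, ModRankLE (fun i j l => algebraMap F K (T i j l)) (fun p j l => algebraMap F K (U p j l))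
      (fun p l i => algebraMap F K (V p l i)) (fun p i j => algebraMap F K (W p i j)) r → ρ ≤ r + g

theorem SmallGap.rot {F K : Type*} [Field F] [Field K] [Algebra F K] {I J L I' J' L' : Type*}
    {T : I → J → L → F} {S : I' → J' → L' → F}
    {U : P → J → L → F} {V : Q → L → I → F} {W : R → I → J → F} {g : ℕ}
    (h : SmallGap F K T S U V W g) :
    SmallGap F K (StrassenDirectSum.rot T) (StrassenDirectSum.rot S) V W U g := by
  obtain ⟨ρ, h1, h2⟩ := h
  refine ⟨ρ, ?_, fun r hr => h2 r ?_⟩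
  · rw [← rot_dsum]
    exact h1.rot
  · exact hr.rot.rot

end Rank

section Gadget

open scoped Classical in
/-- The row factor of the left vectors of the gadget. -/
noncomputable def leftA (k : Type*) [Field k] {J : Type*} (n : ℕ) :
    J ⊕ (Fin (n + 1) × Option J) ⊕ (Fin (n + 1) × Bool) → Fin (n + 1) × Option J → k
  | .inl j, a => if a.2 = some j then 1 else 0
  | .inr (.inl a'), a => if a = a' then 1 else 0
  | .inr (.inr _), _ => 1

open scoped Classical in
/-- The column factor of the left vectors of the gadget. -/
noncomputable def leftB (k : Type*) [Field k] {J : Type*} (n : ℕ) :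
    J ⊕ (Fin (n + 1) × Option J) ⊕ (Fin (n + 1) × Bool) → Fin (n + 1) × Bool → k
  | .inl _, b => if b.2 = true then 1 else 0
  | .inr (.inl _), _ => 1
  | .inr (.inr b'), b => if b = b' then 1 else 0

variable {k : Type*} [Field k] {J L P : Type*} {n : ℕ}

/-- Quadruples indexing the exchange conditions of the gadget. -/
abbrev Quad (J : Type*) (n : ℕ) : Type _ :=
  ((Fin (n + 1) × Option J) × (Fin (n + 1) × Option J)) ×
    ((Fin (n + 1) × Bool) × (Fin (n + 1) × Bool))

/-- A quadruple is allowed if its two rows or its two columns have the same kind. -/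
def Quad.Allowed (q : Quad J n) : Prop := q.1.1.2 = q.1.2.2 ∨ q.2.1.2 = q.2.2.2

open scoped Classical in
/-- The row factor of the right vectors of the gadget. -/
noncomputable def rightA [Fintype J] (w : J → L → k) : L ⊕ Quad J n → Fin (n + 1) × Option J → k
  | .inl l, a => if a.1 = 0 then a.2.elim (-∑ j, w j l) (fun j => w j l) else 0
  | .inr q, a => if q.Allowed then (if a = q.1.1 then 1 else 0) - (if a = q.1.2 then 1 else 0)
      else 0

open scoped Classical in
/-- The column factor of the right vectors of the gadget. -/
noncomputable def rightB : L ⊕ Quad J n → Fin (n + 1) × Bool → k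
  | .inl _, b => if b.1 = 0 then (if b.2 = true then 1 else -1) else 0
  | .inr q, b => (if b = q.2.1 then 1 else 0) - (if b = q.2.2 then 1 else 0)

theorem sum_left_mul_right [Fintype J] (w : J → L → k)
    (j : J ⊕ (Fin (n + 1) × Option J) ⊕ (Fin (n + 1) × Bool)) (l : L ⊕ Quad J n) :
    (∑ a, leftA k n j a * rightA w l a) * ∑ b, leftB k n j b * rightB l b = pad w j l := by
  classical
  rcases j with j | a' | b' <;> rcases l with l | q
  · simp [leftA, leftB, rightA, rightB, Fintype.sum_prod_type]
  · by_cases h : q.Allowed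
    · simp only [leftA, leftB, rightA, rightB, h, mul_sub, Finset.sum_sub_distrib, if_true,
        pad_inr_right]
      rcases h with h | h <;> simp [h]
    · simp [rightA, h]
  · simp [leftB, rightB, Fintype.sum_prod_type]
  · simp [leftB, rightB]
  · simp [leftA, rightA, Fintype.sum_prod_type]
  · by_cases h : q.Allowed <;> simp [leftA, rightA, h]

/-- The index set of the slices added by the gadget. -/
abbrev Slice (P J : Type*) (n : ℕ) : Type _ := P × (Fin (n + 1) × Option J) × (Fin (n + 1) × Bool)

open scoped Classical in
/-- The left vectors of the gadget. -/
noncomputable def left (k : Type*) [Field k] (d : Slice P J n) :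
    J ⊕ P × ((Fin (n + 1) × Option J) ⊕ (Fin (n + 1) × Bool)) → k
  | .inl j => leftA k n (.inl j) d.2.1 * leftB k n (.inl j) d.2.2
  | .inr c => if d.1 = c.1 then leftA k n (.inr c.2) d.2.1 * leftB k n (.inr c.2) d.2.2 else 0

open scoped Classical in
/-- The right vectors of the gadget. -/
noncomputable def right [Fintype J] (U : P → J → L → k) (d : Slice P J n) :
    L ⊕ P × Quad J n → k
  | .inl l => rightA (U d.1) (.inl l) d.2.1 * rightB (n := n) (k := k) (J := J) (.inl l) d.2.2
  | .inr q => if d.1 = q.1 then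
      rightA (U d.1) (.inr q.2) d.2.1 * rightB (L := L) (.inr q.2) d.2.2 else 0

theorem sum_left_right [Fintype J] (U : P → J → L → k) (p : P)
    (j : J ⊕ P × ((Fin (n + 1) × Option J) ⊕ (Fin (n + 1) × Bool))) (l : L ⊕ P × Quad J n) :
    ∑ a, ∑ b, left k (p, a, b) j * right U (p, a, b) l = pad (U p) j l := by
  classical
  have key := sum_left_mul_right (n := n) (U p)
  simp only [Finset.sum_mul_sum, mul_mul_mul_comm _ _ (leftB k n _ _)] at key
  rcases j with j | ⟨p', c⟩ <;> rcases l with l | ⟨p'', q⟩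
  · simpa [left, right] using key (.inl j) (.inl l)
  · by_cases h : p = p''
    · simpa [left, right, h] using key (.inl j) (.inr q)
    · simp [right, h]
  · by_cases h : p = p'
    · simpa [left, right, h] using key (.inr c) (.inl l)
    · simp [left, h]
  · by_cases h : p = p'
    · by_cases h' : p = p''
      · subst h h'
        simpa [left, right] using key (.inr c) (.inr q)
      · simp [right, h']
    · simp [left, h]

/-- The tensor `T` together with the slices `left d ⊗ right d`. -/
noncomputable def gadget [Fintype J] {I : Type*} (n : ℕ) (T : I → J → L → k) (U : P → J → L → k) :
    I ⊕ Slice P J n → J ⊕ P × ((Fin (n + 1) × Option J) ⊕ (Fin (n + 1) × Bool)) →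
      L ⊕ P × Quad J n → k
  | .inl i => pad (T i)
  | .inr d => fun j l => left k d j * right U d l

theorem map_left {k' : Type*} [Field k'] (φ : k →+* k') (d : Slice P J n) (j) :
    φ (left k d j) = left k' d j := by
  classical
  rcases j with j | ⟨p, a | b⟩ <;> simp [left, leftA, leftB, apply_ite φ]

theorem map_right [Fintype J] {k' : Type*} [Field k'] (φ : k →+* k') (U : P → J → L → k)
    (d : Slice P J n) (l) :
    φ (right U d l) = right (fun p j l => φ (U p j l)) d l := by
  classical
  rcases l with l | ⟨p, q⟩
  · rcases d with ⟨p, ⟨a, _ | j⟩, b⟩ <;> simp [right, rightA, rightB, apply_ite φ]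
  · simp [right, rightA, rightB, apply_ite φ]

theorem map_gadget [Fintype J] {I : Type*} {k' : Type*} [Field k'] (φ : k →+* k')
    (T : I → J → L → k) (U : P → J → L → k) :
    (fun i j l => φ (gadget n T U i j l)) =
      gadget n (fun i j l => φ (T i j l)) fun p j l => φ (U p j l) := by
  funext i j l
  rcases i with i | d
  · exact map_pad (T i) φ j l
  · simp [gadget, map_left, map_right]

end Gadget

section Upper

variable {k : Type*} [Field k] {I J L P Q R I' J' L' : Type*} [Fintype J] [Fintype P] [Fintype Q]
  [Fintype R] {n : ℕ}

theorem sum_slice (U : P → J → L → k) (f : P → k)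
    (j : J ⊕ P × ((Fin (n + 1) × Option J) ⊕ (Fin (n + 1) × Bool))) (l : L ⊕ P × Quad J n) :
    ∑ d : Slice P J n, f d.1 * left k d j * right U d l = ∑ p, f p * pad (U p) j l := by
  rw [Fintype.sum_prod_type]
  simp only [mul_assoc, ← Finset.mul_sum]
  refine Finset.sum_congr rfl fun p _ => ?_
  rw [← sum_left_right (n := n), Fintype.sum_prod_type]

/-- Extension of a vector by zero in the middle. -/
def extendMid {X Y Z : Type*} (v : X ⊕ Z → k) : (X ⊕ Y) ⊕ Z → k :=
  Sum.elim (Sum.elim (fun i => v (.inl i)) 0) fun i => v (.inr i)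

theorem ModRankLE.dsum_gadget {T : I → J → L → k} {S : I' → J' → L' → k} {U : P → J → L → k}
    {V : Q → L → I → k} {W : R → I → J → k} {ρ : ℕ}
    (h : ModRankLE (dsum T S) (fun p => pad (U p)) (fun p => pad (V p)) (fun p => pad (W p)) ρ) :
    ModRankLE (dsum (gadget n T U) S) (fun _ : P => pad 0) (fun p => pad (pad (V p)))
      (fun p => pad (pad (W p))) (ρ + Fintype.card (Slice P J n)) := by
  classical
  obtain ⟨x, y, z, a, b, c, h⟩ := h
  refine ⟨0, fun p => extendMid (y p), fun p => extendMid (z p),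
    .of_fintype (ι := Fin ρ ⊕ Slice P J n) (by simp)
    (Sum.elim (fun t => extendMid (a t)) fun d => Sum.elim
      (Sum.elim (fun i => -x d.1 (.inl i)) fun d' => if d = d' then 1 else 0)
        fun i => -x d.1 (.inr i))
    (Sum.elim (fun t => extendMid (b t)) fun d => Sum.elim (left k d) 0)
    (Sum.elim (fun t => extendMid (c t)) fun d => Sum.elim (right U d) 0) fun i j l => ?_⟩
  have key := fun i => sum_slice (n := n) U fun p => x p i
  rcases i with (i | d) | i <;> rcases j with (j | j) | j <;> rcases l with (l | l) | l <;>
    simp [extendMid, dsum, gadget, key, ← h]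
  all_goals ring

end Upper

section LinearAlgebra

variable {k : Type*} [Field k] {ι κ : Type*} [Fintype ι] [Fintype κ]

theorem exists_relation_of_card_lt (s : Finset κ) (h : Fintype.card ι < s.card) (M : ι → κ → k) :
    ∃ v : κ → k, v ≠ 0 ∧ (∀ a, a ∉ s → v a = 0) ∧ ∀ t, ∑ a, v a * M t a = 0 := by
  classical
  have hker : LinearMap.ker (Matrix.mulVecLin (Matrix.of fun t (a : s) => M t a)) ≠ ⊥ :=
    LinearMap.ker_ne_bot_of_finrank_lt (by simpa using h)
  obtain ⟨v, hv, hv0⟩ := Submodule.exists_mem_ne_zero_of_ne_bot hker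
  refine ⟨fun a => if h : a ∈ s then v ⟨a, h⟩ else 0, fun h0 => hv0 ?_, fun a ha => by simp [ha],
    fun t => ?_⟩
  · ext a
    simpa using congr_fun h0 a
  · have := congr_fun (LinearMap.mem_ker.1 hv) t
    rw [← Finset.sum_subset (Finset.subset_univ s) (by simp +contextual), ← Finset.sum_coe_sort]
    simpa [Matrix.mulVec, dotProduct, mul_comm] using this

theorem exists_solvable_rows (s : Finset κ) (M : ι → κ → k)
    (hM : ∀ c : κ → k, (∀ d, d ∉ s → c d = 0) → (∀ t, ∑ d, c d * M t d = 0) → c = 0) :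
    ∃ σ : Finset ι, σ.card = s.card ∧ ∀ g : ι → k, ∃ c : κ → k, (∀ d, d ∉ s → c d = 0) ∧
      ∀ t ∈ σ, ∑ d, c d * M t d = g t := by
  classical
  have extend (c : s → k) (t : ι) :
      ∑ d, (if h : d ∈ s then c ⟨d, h⟩ else 0) * M t d = ∑ d : s, c d * M t d := by
    rw [← Finset.sum_subset (Finset.subset_univ s) (by simp +contextual), ← Finset.sum_coe_sort]
    simp
  have apply_eq (f : (s → k) →ₗ[k] k) (v : s → k) : f v = ∑ d, f (Pi.single d 1) * v d := by
    conv_lhs => rw [← Finset.univ_sum_single v]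
    rw [map_sum]
    refine Finset.sum_congr rfl fun d _ => ?_
    rw [show (Pi.single d (v d) : s → k) = v d • Pi.single d 1 by simp [← Pi.single_smul], map_smul,
      smul_eq_mul, mul_comm]
  let N : ι → s → k := fun t d => M t d
  obtain ⟨ι', a, ha, hspan, hli⟩ := exists_linearIndependent' k N
  have htop : Submodule.span k (Set.range N) = ⊤ := by
    by_contra hne
    obtain ⟨f, hf0, hf⟩ := Submodule.exists_le_ker_of_lt_top _ (lt_top_iff_ne_top.2 hne)
    have hc := hM (fun d => if h : d ∈ s then f (Pi.single ⟨d, h⟩ 1) else 0) (by simp +contextual)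
      fun t => by
        rw [extend fun d => f (Pi.single d 1), ← apply_eq f (N t)]
        exact hf (Submodule.subset_span ⟨t, rfl⟩)
    refine hf0 (LinearMap.ext fun v => ?_)
    rw [apply_eq]
    refine Finset.sum_eq_zero fun d _ => ?_
    have := congr_fun hc d
    simp only [Finset.coe_mem, dif_pos, Pi.zero_apply] at this
    rw [this, zero_mul]
  let B : Module.Basis ι' k (s → k) := .mk hli (by rw [hspan, htop])
  have : Fintype ι' := Fintype.ofInjective a ha
  refine ⟨Finset.univ.map ⟨a, ha⟩, ?_, fun g => ?_⟩
  · have := Module.finrank_eq_card_basis B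
    simpa using this.symm
  · let f := B.constr k fun i => g (a i)
    refine ⟨fun d => if h : d ∈ s then f (Pi.single ⟨d, h⟩ 1) else 0, by simp +contextual, ?_⟩
    intro t ht
    obtain ⟨i, rfl⟩ : ∃ i, a i = t := by simpa using ht
    rw [extend fun d => f (Pi.single d 1), ← apply_eq f (N (a i)),
      ← B.constr_basis k (fun i => g (a i)) i]
    simp [f, B]

end LinearAlgebra

section Exchange

variable {k : Type*} [Field k] {A B CA CB X ι : Type*} [Fintype A] [Fintype ι]

theorem exists_small_exceptional (kind : A → CA) {r : ℕ} (hι : Fintype.card ι ≤ r)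
    (hA : ∀ a, ∀ s : Finset A, s.card ≤ r + 1 → ∃ a', a' ∉ s ∧ kind a' = kind a)
    (x : X → A → B → k) (g : ι → A → k)
    (hx : ∀ i (α : A → k), (∀ t, ∑ a, α a * g t a = 0) → ∀ a₁ a₂ b₁ b₂, kind a₁ = kind a₂ →
      x i a₁ b₁ * α a₁ - x i a₁ b₂ * α a₁ - x i a₂ b₁ * α a₂ + x i a₂ b₂ * α a₂ = 0) :
    ∃ δ : Finset A, δ.card ≤ r ∧ ∀ i a b b', a ∉ δ → x i a b = x i a b' := by
  classical
  refine ⟨Finset.univ.filter fun a => ∃ i b b', x i a b ≠ x i a b', ?_, fun i a b b' h => ?_⟩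
  · by_contra! h
    obtain ⟨s, hs, hcard⟩ := Finset.exists_subset_card_eq (Nat.succ_le_of_lt h)
    obtain ⟨α, hα0, hαs, hα⟩ := exists_relation_of_card_lt s (by omega) g
    obtain ⟨a, ha⟩ := Function.ne_iff.1 hα0
    have has : a ∈ s := by_contra fun h => ha (hαs a h)
    obtain ⟨i, b, b', hb⟩ := (Finset.mem_filter.1 (hs has)).2
    obtain ⟨a', ha', hk⟩ := hA a s hcard.le
    have := hx i α hα a a' b b' hk.symm
    rw [hαs a' ha'] at this
    refine mul_ne_zero (sub_ne_zero.2 hb) ha ?_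
    linear_combination this
  · simp only [Finset.mem_filter, Finset.mem_univ, true_and, not_exists, not_not] at h
    exact h i b b'

theorem eq_const_of_exchange [Fintype B] [Nonempty A] [Nonempty B] (kA : A → CA) (kB : B → CB) {r : ℕ}
    (hι : Fintype.card ι ≤ r)
    (hA : ∀ a, ∀ s : Finset A, s.card ≤ r + 1 → ∃ a', a' ∉ s ∧ kA a' = kA a)
    (hB : ∀ b, ∀ s : Finset B, s.card ≤ r + 1 → ∃ b', b' ∉ s ∧ kB b' = kB b)
    (x : X → A → B → k) (g : ι → A ⊕ B → k)
    (hx : ∀ i (α : A ⊕ B → k), (∀ t, ∑ c, α c * g t c = 0) → ∀ a₁ a₂ b₁ b₂,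
      kA a₁ = kA a₂ ∨ kB b₁ = kB b₂ →
      x i a₁ b₁ * (α (.inl a₁) + α (.inr b₁)) - x i a₁ b₂ * (α (.inl a₁) + α (.inr b₂)) -
        x i a₂ b₁ * (α (.inl a₂) + α (.inr b₁)) + x i a₂ b₂ * (α (.inl a₂) + α (.inr b₂)) = 0) :
    ∃ (δ : Finset A) (ε : Finset B) (y : X → k), δ.card ≤ r ∧ ε.card ≤ r ∧
      ∀ i a b, a ∉ δ ∨ b ∉ ε → x i a b = y i := by
  obtain ⟨δ, hδ, hδx⟩ := exists_small_exceptional kA hι hA x (fun t a => g t (.inl a))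
    fun i α hα a₁ a₂ b₁ b₂ h => by
      simpa using hx i (Sum.elim α 0) (by simpa using hα) a₁ a₂ b₁ b₂ (.inl h)
  obtain ⟨ε, hε, hεx⟩ := exists_small_exceptional kB hι hB (fun i b a => x i a b)
    (fun t b => g t (.inr b)) fun i β hβ b₁ b₂ a₁ a₂ h => by
      have := hx i (Sum.elim 0 β) (by simpa using hβ) a₁ a₂ b₁ b₂ (.inr h)
      simp only [Sum.elim_inl, Sum.elim_inr, Pi.zero_apply, zero_add] at this
      linear_combination this
  obtain ⟨a₀, ha₀, -⟩ := hA (Classical.arbitrary A) δ (by omega)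
  obtain ⟨b₀, hb₀, -⟩ := hB (Classical.arbitrary B) ε (by omega)
  refine ⟨δ, ε, fun i => x i a₀ b₀, hδ, hε, fun i a b h => ?_⟩
  rcases h with h | h
  · rw [hδx i a b b₀ h, hεx i b₀ a a₀ hb₀]
  · rw [hεx i b a a₀ h, hδx i a₀ b b₀ ha₀]

end Exchange

section Lower

variable {k : Type*} [Field k] {I J L P Q R : Type*} [Fintype J] [Fintype P] [Fintype Q]
  [Fintype R] {n : ℕ}

theorem exists_notMem_snd_eq {X : Type*} {r : ℕ} (hn : r < n) (a : Fin (n + 1) × X)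
    (s : Finset (Fin (n + 1) × X)) (hs : s.card ≤ r + 1) : ∃ a', a' ∉ s ∧ a'.2 = a.2 := by
  classical
  by_contra! h
  have hsub : Finset.univ.image (fun i : Fin (n + 1) => (i, a.2)) ⊆ s := by
    intro b hb
    obtain ⟨i, -, rfl⟩ := Finset.mem_image.1 hb
    by_contra hi
    exact h _ hi rfl
  have := Finset.card_le_card hsub
  rw [Finset.card_image_of_injective _ fun i j h => by simpa using h] at this
  simp at this
  omega

theorem sum_contract (U : P → J → L → k) (x : Slice P J n → k)
    (α : (Fin (n + 1) × Option J) ⊕ (Fin (n + 1) × Bool) → k) (p : P) (q : Quad J n)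
    (hq : q.Allowed) :
    ∑ c, α c * ∑ d, x d * (left k d (.inr (p, c)) * right U d (.inr (p, q))) =
      x (p, q.1.1, q.2.1) * (α (.inl q.1.1) + α (.inr q.2.1)) -
      x (p, q.1.1, q.2.2) * (α (.inl q.1.1) + α (.inr q.2.2)) -
      x (p, q.1.2, q.2.1) * (α (.inl q.1.2) + α (.inr q.2.1)) +
      x (p, q.1.2, q.2.2) * (α (.inl q.1.2) + α (.inr q.2.2)) := by
  classical
  have h1 (d : Slice P J n) : ∑ c, α c * left k d (.inr (p, c)) =
      if d.1 = p then α (.inl d.2.1) + α (.inr d.2.2) else 0 := by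
    by_cases h : d.1 = p <;> simp [left, leftA, leftB, h]
  have h2 : ∑ c, α c * ∑ d, x d * (left k d (.inr (p, c)) * right U d (.inr (p, q))) =
      ∑ d, x d * (∑ c, α c * left k d (.inr (p, c))) * right U d (.inr (p, q)) := by
    simp only [Finset.mul_sum, Finset.sum_mul]
    rw [Finset.sum_comm]
    exact Finset.sum_congr rfl fun d _ => Finset.sum_congr rfl fun c _ => by ring
  rw [h2]
  simp only [h1]
  rw [Fintype.sum_prod_type, Finset.sum_eq_single p (fun p' _ hp' => by simp [hp']) (by simp)]
  rw [Fintype.sum_prod_type]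
  simp only [right, rightA, rightB, hq, if_true, mul_sub, mul_ite, mul_one, mul_zero,
    Finset.sum_sub_distrib, Finset.sum_ite_eq', Finset.mem_univ]
  ring

theorem exists_const_of_slices {X ι : Type*} [Fintype ι] {r : ℕ} (hι : Fintype.card ι ≤ r)
    (hn : r < n) (U : P → J → L → k) (x : X → Slice P J n → k) (f : ι → X → k)
    (g : ι → J ⊕ P × ((Fin (n + 1) × Option J) ⊕ (Fin (n + 1) × Bool)) → k)
    (h : ι → L ⊕ P × Quad J n → k) (p : P)
    (hx : ∀ i c q, ∑ d, x i d * (left k d (.inr (p, c)) * right U d (.inr (p, q))) =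
      ∑ t, f t i * g t (.inr (p, c)) * h t (.inr (p, q))) :
    ∃ (δ : Finset (Fin (n + 1) × Option J)) (ε : Finset (Fin (n + 1) × Bool)) (y : X → k),
      δ.card ≤ r ∧ ε.card ≤ r ∧ ∀ i a b, a ∉ δ ∨ b ∉ ε → x i (p, a, b) = y i := by
  refine eq_const_of_exchange Prod.snd Prod.snd hι (exists_notMem_snd_eq hn)
    (exists_notMem_snd_eq hn) (fun i a b => x i (p, a, b)) (fun t c => g t (.inr (p, c)))
    fun i α hα a₁ a₂ b₁ b₂ hq => ?_
  rw [← sum_contract U (x i) α p ((a₁, a₂), (b₁, b₂)) hq]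
  simp only [hx, Finset.mul_sum]
  rw [Finset.sum_comm]
  refine Finset.sum_eq_zero fun t _ => ?_
  have := congr_arg (fun u => f t i * h t (.inr (p, ((a₁, a₂), (b₁, b₂)))) * u) (hα t)
  simp only [Finset.mul_sum, mul_zero] at this
  rw [← this]
  exact Finset.sum_congr rfl fun c _ => by ring

/-- The distinguished slice of each gadget. -/
def special : (Fin (n + 1) × Option J) × (Fin (n + 1) × Bool) := ((0, none), (0, true))

theorem left_right_independent (hn : 0 < n) (U : P → J → L → k) (x : Slice P J n → k)
    (hs : ∀ d, d.2 = special → x d = 0)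
    (hx : ∀ j l, ∑ d, x d * (left k d j * right U d l) = 0) : x = 0 := by
  funext ⟨p, a, b⟩
  obtain ⟨δ, ε, y, hδ, -, h⟩ := exists_const_of_slices (X := Unit) (ι := Empty) le_rfl hn U
    (fun _ => x) (fun t => t.elim) (fun t => t.elim) (fun t => t.elim) p fun _ c q => by
      simpa using hx (.inr (p, c)) (.inr (p, q))
  obtain rfl : δ = ∅ := by simpa using hδ
  have h0 := h () (0, none) (0, true) (by simp)
  rw [hs _ rfl] at h0
  rw [h () a b (by simp), ← h0, Pi.zero_apply]

theorem exists_projection {r : ℕ} (hn : r < n) (U : P → J → L → k)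
    (δ : P → Finset (Fin (n + 1) × Option J)) (ε : P → Finset (Fin (n + 1) × Bool))
    (hδ : ∀ p, (δ p).card ≤ r) (hε : ∀ p, (ε p).card ≤ r) :
    ∃ π : (L ⊕ P × Quad J n → k) →ₗ[k] L → k,
      (∀ v, (∀ q, v (.inr q) = 0) → ∀ l, π v l = v (.inl l)) ∧
      ∀ p, ∀ a ∈ δ p, ∀ b ∈ ε p, π (right U (p, a, b)) = 0 := by
  classical
  choose a' ha' hka using fun p a =>
    exists_notMem_snd_eq hn a (δ p) ((hδ p).trans (Nat.le_succ r))
  choose b' hb' _ using fun p b =>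
    exists_notMem_snd_eq hn b (ε p) ((hε p).trans (Nat.le_succ r))
  refine ⟨
    { toFun := fun v l => v (.inl l) - ∑ p, ∑ a ∈ δ p, ∑ b ∈ ε p,
        right U (p, a, b) (.inl l) * v (.inr (p, (a, a' p a), (b, b' p b)))
      map_add' := fun v w => by
        funext l
        simp only [Pi.add_apply, mul_add, Finset.sum_add_distrib]
        ring
      map_smul' := fun s v => by
        funext l
        simp only [Pi.smul_apply, smul_eq_mul, RingHom.id_apply, mul_sub, Finset.mul_sum,
          mul_left_comm s] }, fun v hv l => ?_, fun p a ha b hb => ?_⟩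
  · simp [hv]
  · funext l
    have hright (p₀ a₀) (ha₀ : a₀ ∈ δ p₀) (b₀) (hb₀ : b₀ ∈ ε p₀) :
        right U (p, a, b) (.inr (p₀, (a₀, a' p₀ a₀), (b₀, b' p₀ b₀))) =
          if p = p₀ then if b = b₀ then if a = a₀ then 1 else 0 else 0 else 0 := by
      by_cases hp : p = p₀
      · subst hp
        have h1 : a ≠ a' p a₀ := fun h => ha' p a₀ (h ▸ ha)
        have h2 : b ≠ b' p b₀ := fun h => hb' p b₀ (h ▸ hb)
        have h3 : Quad.Allowed ((a₀, a' p a₀), (b₀, b' p b₀)) := .inl (hka p a₀).symm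
        simp [right, rightA, rightB, h1, h2, h3]
      · simp [right, hp]
    have hsum : ∑ p₀, ∑ a₀ ∈ δ p₀, ∑ b₀ ∈ ε p₀, right U (p₀, a₀, b₀) (.inl l) *
        right U (p, a, b) (.inr (p₀, (a₀, a' p₀ a₀), (b₀, b' p₀ b₀))) =
        ∑ p₀, ∑ a₀ ∈ δ p₀, ∑ b₀ ∈ ε p₀, right U (p₀, a₀, b₀) (.inl l) *
          if p = p₀ then if b = b₀ then if a = a₀ then 1 else 0 else 0 else 0 :=
      Finset.sum_congr rfl fun p₀ _ => Finset.sum_congr rfl fun a₀ ha₀ =>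
        Finset.sum_congr rfl fun b₀ hb₀ => by rw [hright p₀ a₀ ha₀ b₀ hb₀]
    simp only [LinearMap.coe_mk, AddHom.coe_mk, hsum, Pi.zero_apply]
    rw [Finset.sum_eq_single p (by simp +contextual [eq_comm]) (by simp),
      Finset.sum_eq_single a (by simp +contextual [eq_comm]) (by simp [ha]),
      Finset.sum_eq_single b (by simp +contextual [eq_comm]) (by simp [hb])]
    simp

end Lower

section Stage

variable {k : Type*} [Field k] {I J L P Q R : Type*} [Fintype J] [Fintype P] [Fintype Q]
  [Fintype R] {n : ℕ}

theorem ModRankLE.of_gadget {T : I → J → L → k} {U : P → J → L → k} {V : Q → L → I → k}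
    {W : R → I → J → k} {s : ℕ} (hn : 0 < n)
    (hs : s + Fintype.card P < n + Fintype.card (Slice P J n))
    (h : ModRankLE (gadget n T U) (fun _ : P => 0) (fun p => pad (V p)) (fun p => pad (W p)) s) :
    ∃ r, ModRankLE T U V W r ∧ r + Fintype.card (Slice P J n) ≤ s + Fintype.card P := by
  classical
  obtain ⟨x₀, y, z, f, g, h, hT⟩ := h
  simp only [Pi.zero_apply, mul_zero, Finset.sum_const_zero, add_zero] at hT
  let D : Finset (Slice P J n) := Finset.univ.filter fun d => d.2 ≠ special
  have hD : D.card + Fintype.card P = Fintype.card (Slice P J n) := by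
    have h1 : (Finset.univ.filter fun d : Slice P J n => ¬ d.2 ≠ special).card =
        Fintype.card P := by
      rw [← Finset.card_univ, ← Finset.card_image_of_injective (Finset.univ : Finset P)
        (f := fun p => ((p, special) : Slice P J n)) fun p q hpq => by simpa using hpq]
      congr 1
      ext ⟨p, d⟩
      simp [eq_comm]
    rw [← h1, Finset.card_filter_add_card_filter_not, Finset.card_univ]
  have hslice (d j l) : left k d j * right U d l = ∑ t, f t (.inr d) * g t j * h t l := by
    simpa [gadget] using hT (.inr d) j l
  have hcomb (x : Slice P J n → k) (j l) : ∑ d, x d * (left k d j * right U d l) =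
      ∑ t, (∑ d, x d * f t (.inr d)) * g t j * h t l := by
    simp only [hslice, Finset.mul_sum, Finset.sum_mul]
    rw [Finset.sum_comm]
    exact Finset.sum_congr rfl fun d _ => Finset.sum_congr rfl fun t _ => by ring
  obtain ⟨σ, hσ, hsolve⟩ := exists_solvable_rows D (fun t d => f t (.inr d)) fun c hc hc0 =>
    left_right_independent hn U c (fun d hd => hc d (by simp [D, hd])) fun j l => by
      simp [hcomb, hc0]
  choose x hxD hx using fun i => hsolve fun t => -f t (.inl i)
  have hσs : σ.card ≤ s := by simpa using σ.card_le_univ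
  have hcard : σᶜ.card = s - σ.card := by simp [Finset.card_compl]
  have hι : Fintype.card ↥(σᶜ) ≤ s - σ.card := by simp
  have hrn : s - σ.card < n := by omega
  let f' : Fin s → I → k := fun t i => f t (.inl i) + ∑ d, x i d * f t (.inr d)
  let embJ : J → J ⊕ P × ((Fin (n + 1) × Option J) ⊕ (Fin (n + 1) × Bool)) := .inl
  let embI : I → I ⊕ Slice P J n := .inl
  have key (i j l) : pad (T i) j l + ∑ p, y p j * pad (V p) l (embI i) +
      ∑ p, z p l * pad (W p) (embI i) j + ∑ d, x i d * (left k d j * right U d l) =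
      ∑ t : ↥(σᶜ), f' t i * g t j * h t l := by
    rw [hcomb, show pad (T i) j l = gadget n T U (.inl i) j l from rfl, hT,
      ← Finset.sum_add_distrib, Finset.sum_coe_sort σᶜ fun t => f' t i * g t j * h t l]
    symm
    apply Finset.sum_subset_zero_on_sdiff (Finset.subset_univ _)
    · intro t ht
      have : t ∈ σ := by simpa using ht
      rw [hx i t this]
      ring
    · intro t _
      simp only [f']
      ring
  choose δ ε c hδ hε hc using fun p => exists_const_of_slices hι hrn U x (fun t => f' t)
    (fun t => g t) (fun t => h t) p fun i c q => by simpa [embI] using key i (.inr (p, c)) (.inr (p, q))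
  obtain ⟨π, hπ, hπ0⟩ := exists_projection hrn U δ ε hδ hε
  refine ⟨s - σ.card, ⟨c, fun p j => y p (embJ j), fun p => π (z p), .of_fintype hι
    (fun t => f' t) (fun t j => g t (embJ j)) (fun t => π (h t)) fun i j l => ?_⟩, by omega⟩
  have hkey : pad (T i) (embJ j) + ∑ p, y p (embJ j) • (fun l' => pad (V p) l' (embI i)) +
      ∑ p, W p i j • z p + ∑ d, (x i d * left k d (embJ j)) • right U d =
      ∑ t : ↥(σᶜ), (f' t i * g t (embJ j)) • h t := by
    funext l'
    simpa [embI, embJ, mul_comm (z _ _), mul_assoc] using key i (embJ j) l'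
  have hconst : π (∑ d, (x i d * left k d (embJ j)) • right U d) =
      π (∑ p, c p i • pad (U p) (embJ j)) := by
    have : ∑ p, c p i • pad (U p) (embJ j) =
        ∑ d : Slice P J n, (c d.1 i * left k d (embJ j)) • right U d := by
      funext l'
      simpa using (sum_slice U (fun p => c p i) (embJ j) l').symm
    rw [this, map_sum, map_sum]
    refine Finset.sum_congr rfl fun ⟨p, a, b⟩ _ => ?_
    rw [map_smul, map_smul]
    by_cases hab : a ∈ δ p ∧ b ∈ ε p
    · rw [hπ0 p a hab.1 b hab.2, smul_zero, smul_zero]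
    · rw [hc p i a b (not_and_or.1 hab)]
  have := congr_fun (congr_arg π hkey) l
  rw [map_add, hconst] at this
  simp only [map_add, map_sum, map_smul, Pi.add_apply, Finset.sum_apply, Pi.smul_apply,
    smul_eq_mul] at this
  rw [← this, hπ _ (by simp [embJ])]
  have h1 (p) : π (fun l' => pad (V p) l' (embI i)) l = V p l i := by
    rw [hπ _ (by simp [embI])]
    simp [embI]
  have h2 (p) : π (pad (U p) (embJ j)) l = U p j l := by
    rw [hπ _ (by simp [embJ])]
    simp [embJ]
  simp only [h1, h2, embJ, pad_inl_inl, mul_comm (W _ _ _)]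
  ring

theorem SmallGap.exists_gadget {F K : Type*} [Field F] [Field K] [Algebra F K] {I' J' L' : Type*}
    {T : I → J → L → F} {S : I' → J' → L' → F}
    {U : P → J → L → F} {V : Q → L → I → F} {W : R → I → J → F} {g : ℕ}
    (h : SmallGap F K T S U V W g) : ∃ n,
    SmallGap F K (gadget n T U) S (fun _ : P => 0) (fun p => pad (V p))
      (fun p => pad (W p)) (g + Fintype.card P) := by
  obtain ⟨ρ, h1, h2⟩ := h
  refine ⟨ρ + 1, _, h1.dsum_gadget (n := ρ + 1), fun r hr => ?_⟩
  by_contra! hlt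
  simp only [map_gadget, map_pad, Pi.zero_apply, map_zero] at hr
  obtain ⟨r', hr', hle⟩ := ModRankLE.of_gadget (n := ρ + 1) (by omega) (by omega) hr
  have := h2 r' hr'
  omega

end Stage

section Glue

variable {k : Type*} [Field k] {I J L P Q R τ : Type*} [Fintype P] [Fintype Q] [Fintype R]
  [Fintype τ]

theorem ModRankLE.of_common_decomposition (a : τ → I → k) (b : τ → J → k) (c : τ → L → k)
    (a' : τ → P → k) (b' : τ → Q → k) (c' : τ → R → k) (S : P → Q → R → k)
    (hS : ∀ α β γ, ∑ t, a' t α * b' t β * c' t γ = S α β γ)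
    (ha : ∀ i β γ, ∑ t, a t i * (b' t β * c' t γ) = 0)
    (hb : ∀ j α γ, ∑ t, b t j * (a' t α * c' t γ) = 0)
    (hc : ∀ l α β, ∑ t, c t l * (a' t α * b' t β) = 0) :
    ModRankLE (dsum (fun i j l => ∑ t, a t i * b t j * c t l) S)
      (fun α => pad fun j l => ∑ t, a' t α * b t j * c t l)
      (fun β => pad fun l i => ∑ t, b' t β * c t l * a t i)
      (fun γ => pad fun i j => ∑ t, c' t γ * a t i * b t j) (Fintype.card τ) := by
  classical
  refine ⟨fun α => Sum.elim 0 (Pi.single α 1), fun β => Sum.elim 0 (Pi.single β 1),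
    fun γ => Sum.elim 0 (Pi.single γ 1), .of_fintype le_rfl (fun t => Sum.elim (a t) (a' t))
    (fun t => Sum.elim (b t) (b' t)) (fun t => Sum.elim (c t) (c' t)) fun i j l => ?_⟩
  rcases i with i | α <;> rcases j with j | β <;> rcases l with l | γ <;>
    simp [dsum, Pi.single_apply, hS]
  · exact Finset.sum_congr rfl fun t _ => by ring
  · exact Finset.sum_congr rfl fun t _ => by ring
  · rw [← ha i β γ]
    exact Finset.sum_congr rfl fun t _ => by ring
  · rw [← hb j α γ]
    exact Finset.sum_congr rfl fun t _ => by ring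
  · rw [← hc l α β]
    exact Finset.sum_congr rfl fun t _ => by ring

theorem card_le_of_diagonal {ι κ : Type*} [Fintype ι] [Fintype κ] (σ : Finset κ) (φ : κ → k)
    (hφ : ∀ i ∈ σ, φ i ≠ 0) (A B : ι → κ → k)
    (h : ∀ i ∈ σ, ∀ j ∈ σ, (open scoped Classical in if i = j then φ i else 0) =
      ∑ w, A w i * B w j) :
    σ.card ≤ Fintype.card ι := by
  classical
  by_contra! hlt
  obtain ⟨v, hv0, hvσ, hv⟩ := exists_relation_of_card_lt σ hlt B
  refine hv0 (funext fun i => by_contra fun hi => ?_)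
  have hiσ : i ∈ σ := by_contra fun h => hi (hvσ i h)
  have h1 : ∑ j ∈ σ, v j * ∑ w, A w i * B w j = φ i * v i := by
    rw [Finset.sum_congr rfl fun j hj => by rw [← h i hiσ j hj]]
    simp [hiσ, mul_comm]
  have h2 : ∑ j ∈ σ, v j * ∑ w, A w i * B w j = 0 := by
    rw [Finset.sum_subset (Finset.subset_univ σ) fun j _ hj => by rw [hvσ j hj, zero_mul]]
    simp only [Finset.mul_sum]
    rw [Finset.sum_comm]
    refine Finset.sum_eq_zero fun w _ => ?_
    rw [← mul_zero (A w i), ← hv w, Finset.mul_sum]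
    exact Finset.sum_congr rfl fun j _ => by ring
  exact mul_ne_zero (hφ i hiσ) hi (h1.symm.trans h2)

theorem sum_contract_decomposition {ι : Type*} [Fintype ι] [Fintype I] [Fintype J] [Fintype L]
    (p : I → k) (q : J → k) (y : L → k) (A : ι → I → k) (B : ι → J → k) (C : ι → L → k) :
    ∑ i, ∑ j, ∑ l, p i * q j * y l * ∑ w, A w i * B w j * C w l =
      ∑ w, (∑ i, p i * A w i) * (∑ j, q j * B w j) * ∑ l, y l * C w l := by
  have h (w : ι) : (∑ i, p i * A w i) * (∑ j, q j * B w j) * ∑ l, y l * C w l =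
      ∑ i, ∑ j, ∑ l, p i * q j * y l * (A w i * B w j * C w l) := by
    rw [Finset.sum_mul_sum, Finset.sum_mul]
    refine Finset.sum_congr rfl fun i _ => ?_
    rw [Finset.sum_mul_sum]
    exact Finset.sum_congr rfl fun j _ => Finset.sum_congr rfl fun l _ => by ring
  rw [Finset.sum_congr rfl fun w _ => h w]
  symm
  rw [Finset.sum_comm]
  refine Finset.sum_congr rfl fun i _ => ?_
  rw [Finset.sum_comm]
  refine Finset.sum_congr rfl fun j _ => ?_
  rw [Finset.sum_comm]
  exact Finset.sum_congr rfl fun l _ => (Finset.mul_sum _ _ _).symm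

theorem ModRankLE.le_of_dual [Fintype I] [Fintype J] [Fintype L] (a : τ → I → k) (b : τ → J → k)
    (c : τ → L → k) (a' : τ → P → k) (b' : τ → Q → k) (c' : τ → R → k) {M r : ℕ}
    (hM : Fintype.card P + Fintype.card Q < M) (hL : Fintype.card R < Fintype.card L)
    (hdual : ∀ y : L → k, y ≠ 0 → ∃ σ : Finset τ, σ.card = M ∧
      (∀ t ∈ σ, ∑ l, y l * c t l ≠ 0) ∧ ∃ (p : τ → I → k) (q : τ → J → k), ∀ i ∈ σ, ∀ j ∈ σ, ∀ t,
        (∑ l, p i l * a t l) * (∑ l, q j l * b t l) =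
          (open scoped Classical in if i = j ∧ t = i then 1 else 0))
    (h : ModRankLE (fun i j l => ∑ t, a t i * b t j * c t l)
      (fun α j l => ∑ t, a' t α * b t j * c t l)
      (fun β l i => ∑ t, b' t β * c t l * a t i)
      (fun γ i j => ∑ t, c' t γ * a t i * b t j) r) :
    M + Fintype.card L ≤ Fintype.card P + Fintype.card Q + Fintype.card R + 1 + r := by
  classical
  obtain ⟨x, y', z, f, g, h, hT⟩ := h
  obtain ⟨S, -, hS⟩ := Finset.exists_subset_card_eq (s := (Finset.univ : Finset (Fin r)))
    (n := min (Fintype.card L - Fintype.card R - 1) r) (by simp)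
  obtain ⟨y, hy0, -, hy⟩ := exists_relation_of_card_lt (Finset.univ : Finset L)
    (ι := R ⊕ S) (by simp [hS]; omega) (Sum.elim z fun u => h u)
  have hyz (γ) : ∑ l, y l * z γ l = 0 := hy (.inl γ)
  have hyh (u) (hu : u ∈ S) : ∑ l, y l * h u l = 0 := hy (.inr ⟨u, hu⟩)
  obtain ⟨σ, hσ, hφ, p, q, hpq⟩ := hdual y hy0
  let φ : τ → k := fun t => ∑ l, y l * c t l
  let pa : τ → τ → k := fun i t => ∑ i', p i i' * a t i'
  let qb : τ → τ → k := fun j t => ∑ j', q j j' * b t j'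
  have key (i j) : ∑ t, pa i t * qb j t * φ t +
      ∑ α, (∑ i', p i i' * x α i') * ∑ t, a' t α * qb j t * φ t +
      ∑ β, (∑ t, b' t β * φ t * pa i t) * ∑ j', q j j' * y' β j' =
      ∑ u : ↥(Sᶜ), (∑ i', p i i' * f u i') * ((∑ j', q j j' * g u j') * ∑ l, y l * h u l) := by
    have h1 : ∑ u : ↥(Sᶜ), (∑ i', p i i' * f u i') *
        ((∑ j', q j j' * g u j') * ∑ l, y l * h u l) =
        ∑ u, (∑ i', p i i' * f u i') * (∑ j', q j j' * g u j') * ∑ l, y l * h u l := by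
      rw [Finset.sum_coe_sort Sᶜ fun u => (∑ i', p i i' * f u i') *
        ((∑ j', q j j' * g u j') * ∑ l, y l * h u l)]
      refine Finset.sum_subset_zero_on_sdiff (Finset.subset_univ _) (fun u hu => ?_)
        fun u _ => (mul_assoc _ _ _).symm
      rw [hyh u (by simpa using hu), mul_zero]
    have h2 (i' j' l) : ∑ α, x α i' * ∑ t, a' t α * b t j' * c t l =
        ∑ w : P × τ, x w.1 i' * (a' w.2 w.1 * b w.2 j') * c w.2 l := by
      simp only [Fintype.sum_prod_type, Finset.mul_sum, mul_assoc]
    have h3 (i' j' l) : ∑ β, y' β j' * ∑ t, b' t β * c t l * a t i' =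
        ∑ w : Q × τ, a w.2 i' * y' w.1 j' * (b' w.2 w.1 * c w.2 l) := by
      simp only [Fintype.sum_prod_type, Finset.mul_sum]
      exact Finset.sum_congr rfl fun _ _ => Finset.sum_congr rfl fun _ _ => by ring
    have h4 (i' j' l) : ∑ γ, z γ l * ∑ t, c' t γ * a t i' * b t j' =
        ∑ w : R × τ, (c' w.2 w.1 * a w.2 i') * b w.2 j' * z w.1 l := by
      simp only [Fintype.sum_prod_type, Finset.mul_sum]
      exact Finset.sum_congr rfl fun _ _ => Finset.sum_congr rfl fun _ _ => by ring
    have := congr_arg (fun E : I → J → L → k => ∑ i', ∑ j', ∑ l, p i i' * q j j' * y l * E i' j' l)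
      (funext fun i' => funext fun j' => funext fun l => hT i' j' l)
    simp only [h2, h3, h4, mul_add, Finset.sum_add_distrib, sum_contract_decomposition, hyz,
      mul_zero, Finset.sum_const_zero, add_zero] at this
    rw [h1, ← this]
    have h5 (α t) : ∑ j', q j j' * (a' t α * b t j') = a' t α * qb j t := by
      simp only [qb, Finset.mul_sum, mul_left_comm]
    have h6 (β t) : ∑ l, y l * (b' t β * c t l) = b' t β * φ t := by
      simp only [φ, Finset.mul_sum, mul_left_comm]
    simp only [h5, h6, Fintype.sum_prod_type]
    refine congr_arg₂ _ (congr_arg₂ _ rfl ?_) ?_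
    · refine Finset.sum_congr rfl fun α _ => ?_
      rw [Finset.mul_sum]
      exact Finset.sum_congr rfl fun t _ => by ring
    · refine Finset.sum_congr rfl fun β _ => ?_
      rw [Finset.sum_mul]
      exact Finset.sum_congr rfl fun t _ => by ring
  have hcard := card_le_of_diagonal σ φ hφ (ι := P ⊕ Q ⊕ ↥(Sᶜ))
    (Sum.elim (fun α i => -∑ i', p i i' * x α i') (Sum.elim
      (fun β i => -∑ t, b' t β * φ t * pa i t) fun u i => ∑ i', p i i' * f u i'))
    (Sum.elim (fun α j => ∑ t, a' t α * qb j t * φ t) (Sum.elim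
      (fun β j => ∑ j', q j j' * y' β j') fun u j => (∑ j', q j j' * g u j') * ∑ l, y l * h u l))
    fun i hi j hj => by
      simp only [Fintype.sum_sum_type, Sum.elim_inl, Sum.elim_inr, ← key, neg_mul,
        Finset.sum_neg_distrib]
      have : ∑ t, pa i t * qb j t * φ t = if i = j then φ i else 0 := by
        simp only [pa, qb, hpq i hi j hj]
        by_cases hij : i = j <;> simp [hij]
      rw [← this]
      ring
  simp only [Fintype.card_sum, Fintype.card_coe, Finset.card_compl, Fintype.card_fin, hS,
    hσ] at hcard
  omega

end Glue

section Vandermonde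

variable {k : Type*} [Field k] {τ : Type*} [Fintype τ]

theorem exists_sum_mul_pow_eq {s : τ → k} (hs : Function.Injective s) {N : ℕ} {κ : Type*}
    (e : κ ≃ Fin N) {σ : Finset τ} (hσ : σ.card = N) (w : κ → k) :
    ∃ d : τ → k, (∀ t ∉ σ, d t = 0) ∧ ∀ x, ∑ t, d t * s t ^ (e x : ℕ) = w x := by
  classical
  let f : Fin N ↪ τ := (σ.equivFinOfCardEq hσ).symm.toEmbedding.trans (.subtype _)
  have hf (u) : f u ∈ σ := ((σ.equivFinOfCardEq hσ).symm u).2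
  let A := Matrix.vandermonde (s ∘ f)
  have hA : IsUnit A.det :=
    (Matrix.det_vandermonde_ne_zero_iff.2 (hs.comp f.injective)).isUnit
  obtain ⟨x, hx⟩ : ∃ x, Matrix.vecMul x A = w ∘ e.symm :=
    ⟨Matrix.vecMul (w ∘ e.symm) A⁻¹, by simp [Matrix.vecMul_vecMul, Matrix.nonsing_inv_mul _ hA]⟩
  have hext {t} (ht : ¬ ∃ u, f u = t) : Function.extend f x 0 t = 0 :=
    Function.extend_apply' _ _ _ ht
  refine ⟨Function.extend f x 0, fun t ht => hext ?_, fun n => ?_⟩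
  · rintro ⟨u, rfl⟩
    exact ht (hf u)
  · rw [← Finset.sum_subset (Finset.subset_univ (Finset.univ.map f)), Finset.sum_map]
    · simpa [f.injective.extend_apply, Matrix.vecMul, dotProduct, A] using congr_fun hx (e n)
    · intro t _ ht
      rw [hext (by simpa using ht), zero_mul]

theorem card_lt_of_sum_mul_pow_eq_zero {s : τ → k} (hs : Function.Injective s) {φ : τ → k}
    (hφ : φ ≠ 0) {σ : Finset τ} (hσ : ∀ t, t ∈ σ ↔ φ t ≠ 0) {N : ℕ}
    (h : ∀ n < N, ∑ t, φ t * s t ^ n = 0) : N < σ.card := by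
  by_contra! hle
  let e := σ.equivFin.symm
  have h0 : (fun u => φ (e u)) = 0 := by
    refine Matrix.eq_zero_of_forall_pow_sum_mul_pow_eq_zero (f := fun u => s (e u))
      (hs.comp (Subtype.val_injective.comp e.injective)) fun i => ?_
    rw [← h i (i.2.trans_le hle), e.sum_comp fun t : σ => φ t * s t ^ (i : ℕ),
      Finset.sum_coe_sort σ fun t => φ t * s t ^ (i : ℕ)]
    refine Finset.sum_subset (Finset.subset_univ _) fun t _ ht => ?_
    rw [not_not.1 (mt (hσ t).2 ht), zero_mul]
  refine hφ (funext fun t => by_contra fun ht => ht ?_)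
  simpa using congr_fun h0 (e.symm ⟨t, (hσ t).2 ht⟩)

theorem exists_sum_mul_pow_mul_pow_eq {s : τ → k} (hs : Function.Injective s) {m : ℕ}
    {σ : Finset τ} (hσ : σ.card = m * m) (w : Fin m → Fin m → k) :
    ∃ d : τ → k, (∀ t ∉ σ, d t = 0) ∧
      ∀ α β : Fin m, ∑ t, d t * (s t ^ (α : ℕ) * s t ^ (m * β : ℕ)) = w α β := by
  obtain ⟨d, h0, h⟩ := exists_sum_mul_pow_eq hs finProdFinEquiv hσ fun x => w x.2 x.1
  refine ⟨d, h0, fun α β => ?_⟩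
  rw [← h (β, α)]
  simp [pow_add]

theorem exists_sum_mul_pow_mul_pow_mul_pow_eq {s : τ → k} (hs : Function.Injective s) {m : ℕ}
    {σ : Finset τ} (hσ : σ.card = m * (m * m)) (w : Fin m → Fin m → Fin m → k) :
    ∃ d : τ → k, (∀ t ∉ σ, d t = 0) ∧ ∀ α β γ : Fin m,
      ∑ t, d t * (s t ^ (α : ℕ) * s t ^ (m * β : ℕ) * s t ^ (m * m * γ : ℕ)) = w α β γ := by
  obtain ⟨d, h0, h⟩ := exists_sum_mul_pow_eq hs
    (((Equiv.refl _).prodCongr finProdFinEquiv).trans finProdFinEquiv) hσ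
    fun x : Fin m × Fin m × Fin m => w x.2.2 x.2.1 x.1
  refine ⟨d, h0, fun α β γ => ?_⟩
  rw [← h (γ, β, α)]
  simp [pow_add]

end Vandermonde

theorem exists_spanning_family {k τ : Type*} [Field k] [Finite τ] (W : Submodule k (τ → k)) :
    ∃ (n : ℕ) (a : τ → Fin n → k), (∀ i, (fun t => a t i) ∈ W) ∧
      ∀ ψ ∈ W, ∃ p : Fin n → k, ∀ t, ∑ i, p i * a t i = ψ t := by
  let B := Module.finBasis k W
  refine ⟨_, fun t i => (B i : τ → k) t, fun i => (B i).2, fun ψ hψ =>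
    ⟨B.repr ⟨ψ, hψ⟩, fun t => ?_⟩⟩
  have := congr_fun (congr_arg Subtype.val (B.sum_repr ⟨ψ, hψ⟩)) t
  simpa [-Module.Basis.sum_repr] using this

theorem exists_annihilating_family {k τ ι κ : Type*} [Field k] [Fintype τ] (f : τ → ι → k)
    (g : τ → κ → k) :
    ∃ (n : ℕ) (a : τ → Fin n → k), (∀ i x y, ∑ t, a t i * (f t x * g t y) = 0) ∧
      ∀ ψ : τ → k, (∀ x y, ∑ t, ψ t * (f t x * g t y) = 0) →
        ∃ p : Fin n → k, ∀ t, ∑ i, p i * a t i = ψ t := by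
  let W : Submodule k (τ → k) :=
    ⨅ x, ⨅ y, LinearMap.ker (Fintype.linearCombination k fun t => f t x * g t y)
  have hW (ψ : τ → k) : ψ ∈ W ↔ ∀ x y, ∑ t, ψ t * (f t x * g t y) = 0 := by
    simp [W, Fintype.linearCombination_apply]
  obtain ⟨n, a, h1, h2⟩ := exists_spanning_family W
  exact ⟨n, a, fun i => (hW _).1 (h1 i), fun ψ hψ => h2 ψ ((hW ψ).2 hψ)⟩

section Base

variable {k τ : Type*} [Field k] [Fintype τ]

/-- A perturbation of a standard basis vector by a vector supported on a
prescribed set of Vandermonde nodes annihilates all the products of two families. -/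
theorem exists_single_add {s : τ → k} (hs : Function.Injective s) {m : ℕ} [NeZero m]
    {σ : Finset τ} (hσ : σ.card = m * (m * m)) (w : Fin m → Fin m → Fin m → τ → k)
    (hw : ∀ α β γ, ∀ t ∈ σ,
      w α β γ t = s t ^ (α : ℕ) * s t ^ (m * β : ℕ) * s t ^ (m * m * γ : ℕ)) (i : τ) :
    ∃ ψ : τ → k, (∀ t ∉ σ, ψ t = (open scoped Classical in if t = i then 1 else 0)) ∧
      ∀ α β γ, ∑ t, ψ t * w α β γ t = 0 := by
  classical
  obtain ⟨d, hd, h⟩ := exists_sum_mul_pow_mul_pow_mul_pow_eq hs hσ fun α β γ => -w α β γ i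
  refine ⟨fun t => d t + if t = i then 1 else 0, fun t ht => by simp [hd t ht], fun α β γ => ?_⟩
  have : ∑ t, d t * w α β γ t = -w α β γ i := by
    rw [← h]
    refine Finset.sum_congr rfl fun t _ => ?_
    by_cases ht : t ∈ σ
    · rw [hw α β γ t ht]
    · simp [hd t ht]
  simp [add_mul, Finset.sum_add_distrib, this]

theorem exists_smallGap (F K : Type*) [Field F] [Field K] [Algebra F K] [Infinite F] {m : ℕ}
    (hm : 2 ≤ m) (S : Fin m → Fin m → Fin m → F) :
    ∃ (n₁ n₂ n₃ : ℕ) (T : Fin n₁ → Fin n₂ → Fin n₃ → F) (U : Fin m → Fin n₂ → Fin n₃ → F)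
      (V : Fin m → Fin n₃ → Fin n₁ → F) (W : Fin m → Fin n₁ → Fin n₂ → F),
      SmallGap F K T S U V W (3 * m) := by
  classical
  have : NeZero m := ⟨by omega⟩
  let N := m * m + 1 + 2 * (m * (m * m))
  let s : Fin (m * m) ⊕ Fin N → F := fun t => Infinite.natEmbedding F (finSumFinEquiv t : ℕ)
  have hs : Function.Injective s := (Infinite.natEmbedding F).injective.comp
    (Fin.val_injective.comp finSumFinEquiv.injective)
  let σ₀ : Finset (Fin (m * m) ⊕ Fin N) := Finset.univ.map .inl
  have hσ₀ : σ₀.card = m * m := by simp [σ₀]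
  have hinr (t : Fin N) : Sum.inr t ∉ σ₀ := by simp [σ₀]
  let a' := fun (t : Fin (m * m) ⊕ Fin N) (α : Fin m) => s t ^ (α : ℕ)
  let b' := fun (t : Fin (m * m) ⊕ Fin N) (β : Fin m) => s t ^ (m * β : ℕ)
  obtain ⟨c', hc', hS⟩ : ∃ c' : Fin (m * m) ⊕ Fin N → Fin m → F,
      (∀ t γ, c' (.inr t) γ = s (.inr t) ^ (m * m * γ : ℕ)) ∧
      ∀ α β γ, ∑ t, a' t α * b' t β * c' t γ = S α β γ := by
    choose d hd h using fun γ : Fin m => exists_sum_mul_pow_mul_pow_eq hs hσ₀ fun α β =>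
      S α β γ - ∑ t : Fin N, a' (.inr t) α * b' (.inr t) β * s (.inr t) ^ (m * m * γ : ℕ)
    refine ⟨Sum.elim (fun t γ => d γ (.inl t)) fun t γ => s (.inr t) ^ (m * m * γ : ℕ),
      fun _ _ => rfl, fun α β γ => ?_⟩
    have := h γ α β
    simp only [Fintype.sum_sum_type, hd γ _ (hinr _), zero_mul, Finset.sum_const_zero,
      add_zero] at this
    simp only [Fintype.sum_sum_type, Sum.elim_inl, Sum.elim_inr]
    rw [← eq_sub_iff_add_eq, ← this]
    exact Finset.sum_congr rfl fun t _ => mul_comm _ _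
  obtain ⟨c, hc, hc0⟩ : ∃ c : Fin (m * m) ⊕ Fin N → Fin N → F,
      (∀ t l, c (.inr t) l = if l = t then 1 else 0) ∧
      ∀ l α β, ∑ t, c t l * (a' t α * b' t β) = 0 := by
    choose d hd h using fun l : Fin N => exists_sum_mul_pow_mul_pow_eq hs hσ₀ fun α β =>
      -(a' (.inr l) α * b' (.inr l) β)
    refine ⟨Sum.elim (fun t l => d l (.inl t)) fun t l => if l = t then 1 else 0,
      fun _ _ => rfl, fun l α β => ?_⟩
    have := h l α β
    simp only [Fintype.sum_sum_type, hd l _ (hinr _), zero_mul, Finset.sum_const_zero,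
      add_zero] at this
    simp [Fintype.sum_sum_type, a', b', this]
  obtain ⟨n₁, a, ha, hp⟩ := exists_annihilating_family b' c'
  obtain ⟨n₂, b, hb, hq⟩ := exists_annihilating_family a' c'
  refine ⟨n₁, n₂, N, _, _, _, _, _, ModRankLE.of_common_decomposition a b c a' b' c' S hS ha hb hc0,
    fun r hr => ?_⟩
  let A := algebraMap F K
  simp only [map_sum, map_mul] at hr
  have := ModRankLE.le_of_dual (fun t i => A (a t i)) (fun t i => A (b t i)) (fun t i => A (c t i))
    (fun t i => A (a' t i)) (fun t i => A (b' t i)) (fun t i => A (c' t i)) (M := m * m + 1)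
    (by simp only [Fintype.card_fin]; nlinarith)
    (by simp only [Fintype.card_fin, N]; nlinarith [Nat.zero_le (m * (m * m))]) (fun y hy => ?_) hr
  · simp only [Fintype.card_fin, Fintype.card_sum] at this ⊢
    omega
  · have hφ0 : (fun t => ∑ l, y l * A (c t l)) ≠ 0 := fun h => hy <| funext fun l => by
      simpa [hc, apply_ite] using congr_fun h (.inr l)
    have hlt := card_lt_of_sum_mul_pow_eq_zero (A.injective.comp hs) hφ0
      (σ := {t | ∑ l, y l * A (c t l) ≠ 0}) (by simp) (N := m * m) fun n hn => by
        obtain ⟨⟨β, α⟩, hβα⟩ := finProdFinEquiv.surjective ⟨n, hn⟩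
        have hn : n = α + m * β := by simpa using (congr_arg Fin.val hβα).symm
        simp only [Finset.sum_mul]
        rw [Finset.sum_comm]
        refine Finset.sum_eq_zero fun l _ => ?_
        have := congr_arg A (hc0 l α β)
        simp only [map_sum, map_mul, map_zero, a', b', ← pow_add, map_pow, ← hn] at this
        simp only [mul_assoc, ← Finset.mul_sum, Function.comp_apply, this, mul_zero]
    obtain ⟨σ, hσ, hσM⟩ := Finset.exists_subset_card_eq hlt
    refine ⟨σ, hσM, fun t ht => by simpa using hσ ht, ?_⟩
    obtain ⟨σa, hσa, hσac⟩ := Finset.exists_subset_card_eq (n := m * (m * m))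
      (s := (Finset.univ.map .inr : Finset (Fin (m * m) ⊕ Fin N)) \ σ) (by
        have := Finset.le_card_sdiff σ (Finset.univ.map .inr : Finset (Fin (m * m) ⊕ Fin N))
        simp only [Finset.card_map, Finset.card_univ, Fintype.card_fin, N] at this
        omega)
    obtain ⟨σb, hσb, hσbc⟩ := Finset.exists_subset_card_eq (n := m * (m * m))
      (s := ((Finset.univ.map .inr : Finset (Fin (m * m) ⊕ Fin N)) \ σ) \ σa) (by
        have h1 := Finset.le_card_sdiff σ (Finset.univ.map .inr : Finset (Fin (m * m) ⊕ Fin N))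
        have h2 := Finset.le_card_sdiff σa
          ((Finset.univ.map .inr : Finset (Fin (m * m) ⊕ Fin N)) \ σ)
        simp only [Finset.card_map, Finset.card_univ, Fintype.card_fin, N] at h1
        omega)
    have hc'' {t} (ht : t ∈ (Finset.univ.map .inr : Finset (Fin (m * m) ⊕ Fin N)) \ σ) (γ) :
        c' t γ = s t ^ (m * m * γ : ℕ) := by
      obtain ⟨t, -, rfl⟩ := Finset.mem_map.1 (Finset.mem_sdiff.1 ht).1
      exact hc' t γ
    choose ψ hψ hψ0 using exists_single_add hs hσac (fun α β γ t => a' t α * b' t β * c' t γ)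
      fun α β γ t ht => by simp only [a', b', hc'' (hσa ht)]
    choose χ hχ hχ0 using exists_single_add hs hσbc (fun α β γ t => a' t α * b' t β * c' t γ)
      fun α β γ t ht => by simp only [a', b', hc'' (Finset.mem_sdiff.1 (hσb ht)).1]
    choose p hp using fun i => hp (ψ i) fun β γ => by simpa [a'] using hψ0 i 0 β γ
    choose q hq using fun i => hq (χ i) fun α γ => by simpa [b'] using hχ0 i α 0 γ
    refine ⟨fun i l => A (p i l), fun i l => A (q i l), fun i hi j hj t => ?_⟩
    simp only [← map_mul, ← map_sum, hp, hq]
    have h1 (h : t ∈ σa) : t ∉ σ ∧ t ∉ σb :=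
      ⟨(Finset.mem_sdiff.1 (hσa h)).2, fun h' => (Finset.mem_sdiff.1 (hσb h')).2 h⟩
    have h2 (h : t ∈ σb) : t ∉ σ := (Finset.mem_sdiff.1 (Finset.mem_sdiff.1 (hσb h)).1).2
    by_cases hta : t ∈ σa
    · have hti : t ≠ i := fun h => (h1 hta).1 (h ▸ hi)
      have htj : t ≠ j := fun h => (h1 hta).1 (h ▸ hj)
      simp [hχ j t (h1 hta).2, hti, htj]
    · by_cases htb : t ∈ σb
      · have hti : t ≠ i := fun h => h2 htb (h ▸ hi)
        simp [hψ i t hta, hti]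
      · rw [hψ i t hta, hχ j t htb]
        by_cases hti : t = i <;> by_cases htj : t = j <;> grind

end Base

theorem exists_not_rankLE_map (F K : Type*) [Field F] [Field K] [Algebra F K] [Infinite F]
    {m r : ℕ} (h : 3 * (r * m) < m * (m * m)) :
    ∃ S : Fin m → Fin m → Fin m → F, ¬ RankLE r fun i j l => algebraMap F K (S i j l) := by
  classical
  let X : Fin 3 → Fin r → Fin m → MvPolynomial (Fin 3 × Fin r × Fin m) K :=
    fun u t i => .X (u, t, i)
  let x : Fin m × Fin m × Fin m → MvPolynomial (Fin 3 × Fin r × Fin m) K :=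
    fun i => ∑ t, X 0 t i.1 * X 1 t i.2.1 * X 2 t i.2.2
  have hx : ¬ AlgebraicIndependent K x := fun hx => by
    have := hx.lift_cardinalMk_le_trdeg
    rw [MvPolynomial.trdeg_of_isDomain] at this
    simp only [Cardinal.mk_fintype, Fintype.card_prod, Fintype.card_fin, Cardinal.lift_natCast,
      Nat.cast_le] at this
    omega
  rw [algebraicIndependent_iff] at hx
  push Not at hx
  obtain ⟨q, hq, hq0⟩ := hx
  by_contra! hS
  refine hq0 (MvPolynomial.funext_set (fun _ => Set.range (algebraMap F K))
    (fun _ => Set.infinite_range_of_injective (algebraMap F K).injective) fun y hy => ?_)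
  choose S hS' using fun i => hy i trivial
  obtain ⟨a, b, c, habc⟩ := hS fun i j l => S (i, j, l)
  have hy' : y = fun i => MvPolynomial.aeval (fun w : Fin 3 × Fin r × Fin m =>
      (![a, b, c] : Fin 3 → Fin r → Fin m → K) w.1 w.2.1 w.2.2) (x i) := by
    funext i
    simp [← hS', habc, x, X]
  rw [map_zero, ← MvPolynomial.coe_aeval_eq_eval, RingHom.coe_coe, hy',
    ← MvPolynomial.comp_aeval_apply, hq, map_zero]

section Conclusion

variable {F K : Type*} [Field F] [Field K] [Algebra F K] {I J L I' J' L' P Q R : Type*}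
  [Fintype I] [Fintype J] [Fintype L] [Fintype P] [Fintype Q] [Fintype R]

theorem SmallGap.exists_fin {T : I → J → L → F} {S : I' → J' → L' → F} {g : ℕ}
    (h : SmallGap F K T S (fun _ : P => 0) (fun _ : Q => 0) (fun _ : R => 0) g) :
    ∃ (n₁ n₂ n₃ : ℕ) (T' : Fin n₁ → Fin n₂ → Fin n₃ → F) (ρ : ℕ), RankLE ρ (dsum T' S) ∧
      ∀ r, RankLE r (fun i j l => algebraMap F K (T' i j l)) → ρ ≤ r + g := by
  obtain ⟨ρ, ⟨_, _, _, h1⟩, h2⟩ := h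
  let e₁ := Fintype.equivFin I
  let e₂ := Fintype.equivFin J
  let e₃ := Fintype.equivFin L
  refine ⟨_, _, _, fun i j l => T (e₁.symm i) (e₂.symm j) (e₃.symm l), ρ, ?_, fun r hr =>
    h2 r ⟨0, 0, 0, ?_⟩⟩
  · convert h1.comp (Sum.map e₁.symm id) (Sum.map e₂.symm id) (Sum.map e₃.symm id) using 1
    funext i j l
    rcases i with i | i <;> rcases j with j | j <;> rcases l with l | l <;> simp [dsum]
  · simpa using hr.comp e₁ e₂ e₃

set_option synthInstance.maxSize 2000 in
theorem SmallGap.exists_rankLE {T : I → J → L → F} {S : I' → J' → L' → F}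
    {U : P → J → L → F} {V : Q → L → I → F} {W : R → I → J → F} {g : ℕ}
    (h : SmallGap F K T S U V W g) :
    ∃ (n₁ n₂ n₃ : ℕ) (T' : Fin n₁ → Fin n₂ → Fin n₃ → F) (ρ : ℕ), RankLE ρ (dsum T' S) ∧
      ∀ r, RankLE r (fun i j l => algebraMap F K (T' i j l)) →
        ρ ≤ r + (g + Fintype.card P + Fintype.card Q + Fintype.card R) := by
  classical
  obtain ⟨_, h⟩ := h.exists_gadget
  obtain ⟨_, h⟩ := h.rot.exists_gadget
  obtain ⟨_, h⟩ := h.rot.exists_gadget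
  simp only [pad_zero] at h
  exact h.rot.exists_fin

end Conclusion

theorem exists_trank_dsum_lt (F K : Type*) [Field F] [Field K] [Algebra F K] [Infinite F] :
    ∃ (a b c a' b' c' : ℕ) (T1 : Fin a → Fin b → Fin c → F)
      (T2 : Fin a' → Fin b' → Fin c' → F),
      trank F (dsum T1 T2) < trank K (fun i j k => algebraMap F K (T1 i j k)) +
        trank K (fun i j k => algebraMap F K (T2 i j k)) := by
  obtain ⟨S, hS⟩ := exists_not_rankLE_map F K (m := 19) (r := 6 * 19) (by norm_num)
  obtain ⟨_, _, _, T, U, V, W, h⟩ := exists_smallGap F K (by norm_num) S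
  obtain ⟨_, _, _, T, ρ, h1, h2⟩ := h.exists_rankLE
  refine ⟨_, _, _, _, _, _, T, S, (trank_le h1).trans_lt ?_⟩
  have hT := h2 _ (rankLE_trank _)
  have hS' := not_le.1 fun h => hS ((rankLE_trank _).mono h)
  simp only [Fintype.card_fin] at hT
  omega

theorem trank_map_le {k k' I J L : Type*} [Field k] [Field k'] [Finite I] [Finite J] (φ : k →+* k')
    (T : I → J → L → k) : trank k' (fun i j l => φ (T i j l)) ≤ trank k T :=
  trank_le ((rankLE_trank T).map φ)

end StrassenDirectSum

/-- Strassen's direct sum conjecture is false: over any infinite field `F` there are tensors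
`T1`, `T2` with `rank_F(T1 ⊕ T2) < rank_{F̄}(T1) + rank_{F̄}(T2)`, where `F̄` is the algebraic
closure of `F`; in particular `rank_F(T1 ⊕ T2) < rank_F(T1) + rank_F(T2)`. -/
theorem strassen_direct_sum_false (F : Type*) [Field F] [Infinite F] :
    ∃ (a b c a' b' c' : ℕ) (T1 : Fin a → Fin b → Fin c → F)
      (T2 : Fin a' → Fin b' → Fin c' → F),
      (trank F (dsum T1 T2) <
        trank (AlgebraicClosure F)
          (fun i j k => algebraMap F (AlgebraicClosure F) (T1 i j k)) +
        trank (AlgebraicClosure F)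
          (fun i j k => algebraMap F (AlgebraicClosure F) (T2 i j k))) ∧
      trank F (dsum T1 T2) < trank F T1 + trank F T2 := by
  obtain ⟨a, b, c, a', b', c', T1, T2, h⟩ :=
    StrassenDirectSum.exists_trank_dsum_lt F (AlgebraicClosure F)
  exact ⟨a, b, c, a', b', c', T1, T2, h, h.trans_le (Nat.add_le_add
    (StrassenDirectSum.trank_map_le _ T1) (StrassenDirectSum.trank_map_le _ T2))⟩
end

section
/- Let T ∈ F^(I×J×K) and let 𝒯 be the tensor obtained from T by adjoining, as new 1-, 2-, and 3-slices, finite sets 𝓜_1, 𝓜_2, 𝓜_3 of matrices spanning subspaces V_1, V_2, V_3 respectively. Then rank_F(𝒯) ≥ min{rank_F(T') : T' ∈ T mod (V_1,V_2,V_3)} + dim V_1 + dim V_2 + dim V_3, with equality if all matrices in 𝓜_1 ∪ 𝓜_2 ∪ 𝓜_3 have rank one. -/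
/-- The tensor obtained from `T` by adjoining the matrices `A1 m` as new 1-slices,
`A2 m` as new 2-slices and `A3 m` as new 3-slices: each new slice agrees with the
corresponding matrix on the original index sets and vanishes on all new indices. -/
def adjoinT {F I J K M1 M2 M3 : Type*} [Zero F]
    (T : I → J → K → F) (A1 : M1 → Matrix J K F) (A2 : M2 → Matrix I K F)
    (A3 : M3 → Matrix I J F) : (I ⊕ M1) → (J ⊕ M2) → (K ⊕ M3) → F
  | Sum.inl i, Sum.inl j, Sum.inl k => T i j k
  | Sum.inr m, Sum.inl j, Sum.inl k => A1 m j k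
  | Sum.inl i, Sum.inr m, Sum.inl k => A2 m i k
  | Sum.inl i, Sum.inl j, Sum.inr m => A3 m i j
  | _, _, _ => 0

/-- `T mod (V1,V2,V3)`: tensors obtained from `T` by adding elements of `V1` to the 1-slices,
elements of `V2` to the 2-slices, and elements of `V3` to the 3-slices. -/
def modSet {F I J K : Type*} [Field F] (T : I → J → K → F)
    (V1 : Submodule F (Matrix J K F)) (V2 : Submodule F (Matrix I K F))
    (V3 : Submodule F (Matrix I J F)) : Set (I → J → K → F) :=
  {T' | ∃ f : I → Matrix J K F, (∀ i, f i ∈ V1) ∧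
    ∃ g : J → Matrix I K F, (∀ j, g j ∈ V2) ∧
    ∃ h : K → Matrix I J F, (∀ k, h k ∈ V3) ∧
    ∀ i j k, T' i j k = T i j k + f i j k + g j i k + h k i j}

theorem exists_subfamily_span_mod {F V ι : Type*} [Field F] [AddCommGroup V] [Module F V]
    [Fintype ι] (v : ι → V) (P : Submodule F V) (hP : P ≤ Submodule.span F (Set.range v)) :
    ∃ (n : ℕ) (τ : Fin n → ι), n + Module.finrank F P ≤ Fintype.card ι ∧
      ∀ x ∈ Submodule.span F (Set.range v), ∃ p ∈ P, ∃ c : Fin n → F,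
        x = p + ∑ t, c t • v (τ t) := by
  set U := Submodule.span F (Set.range v) with hU
  have : FiniteDimensional F U := FiniteDimensional.span_of_finite F (Set.finite_range v)
  have : FiniteDimensional F (Submodule.span F (Set.range (P.mkQ ∘ v))) :=
    FiniteDimensional.span_of_finite F (Set.finite_range _)
  have hmap : U.map P.mkQ = Submodule.span F (Set.range (P.mkQ ∘ v)) := by
    rw [hU, Submodule.map_span, Set.range_comp]
  obtain ⟨f, hf, hspan, -⟩ := Submodule.exists_fun_fin_finrank_span_eq F (Set.range (P.mkQ ∘ v))
  choose τ hτ using hf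
  refine ⟨_, τ, ?_, ?_⟩
  · have hrk := (P.mkQ.domRestrict U).finrank_range_add_finrank_ker
    have hker : LinearMap.ker (P.mkQ.domRestrict U) = P.comap U.subtype := by
      ext x
      simp [LinearMap.mem_ker]
    rw [LinearMap.range_domRestrict, hmap, hker,
      (Submodule.comapSubtypeEquivOfLe hP).finrank_eq] at hrk
    rw [hrk]
    exact finrank_range_le_card v
  · intro x hx
    have hx' : P.mkQ x ∈ Submodule.span F (Set.range f) := by
      rw [hspan, ← hmap]
      exact Submodule.mem_map_of_mem hx
    obtain ⟨c, hc⟩ := (Submodule.mem_span_range_iff_exists_fun F).1 hx'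
    refine ⟨x - ∑ t, c t • v (τ t), ?_, c, by simp⟩
    refine (Submodule.Quotient.mk_eq_zero P).1 ?_
    rw [← Submodule.mkQ_apply, map_sub, map_sum, ← hc, sub_eq_zero]
    exact Finset.sum_congr rfl fun t _ => by rw [map_smul, ← hτ t]; rfl

theorem trank_le_card {F I J K ι : Type*} [Field F] [Fintype ι] {T : I → J → K → F}
    (a : ι → I → F) (b : ι → J → F) (c : ι → K → F)
    (h : ∀ i j k, T i j k = ∑ t, a t i * b t j * c t k) : trank F T ≤ Fintype.card ι := by
  let e := (Fintype.equivFin ι).symm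
  refine Nat.sInf_le ⟨a ∘ e, b ∘ e, c ∘ e, fun i j k => ?_⟩
  rw [h]
  exact (e.sum_comp fun t => a t i * b t j * c t k).symm

theorem exists_trank_decomposition {F I J K : Type*} [Field F] [Finite I] [Finite J] [Finite K]
    (T : I → J → K → F) :
    ∃ (a : Fin (trank F T) → I → F) (b : Fin (trank F T) → J → F) (c : Fin (trank F T) → K → F),
      ∀ i j k, T i j k = ∑ t, a t i * b t j * c t k := by
  classical
  have := Fintype.ofFinite I
  have := Fintype.ofFinite J
  have := Fintype.ofFinite K
  let e := (Fintype.equivFin (I × J × K)).symm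
  refine Nat.sInf_mem (s := {r | ∃ a : Fin r → I → F, ∃ b : Fin r → J → F, ∃ c : Fin r → K → F,
    ∀ i j k, T i j k = ∑ t, a t i * b t j * c t k}) ⟨Fintype.card (I × J × K),
    fun t i => if i = (e t).1 then 1 else 0, fun t j => if j = (e t).2.1 then 1 else 0,
    fun t k => if k = (e t).2.2 then T (e t).1 (e t).2.1 (e t).2.2 else 0, fun i j k => ?_⟩
  rw [e.sum_comp fun t => (if i = t.1 then (1 : F) else 0) * (if j = t.2.1 then 1 else 0) *
    (if k = t.2.2 then T t.1 t.2.1 t.2.2 else 0)]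
  rw [Finset.sum_eq_single (i, j, k)]
  · simp
  · rintro ⟨i', j', k'⟩ - hne
    by_cases hi : i = i' <;> by_cases hj : j = j' <;> by_cases hk : k = k' <;> simp_all
  · simp

theorem trank_swap {F I J K : Type*} [Field F] [Finite I] [Finite J] [Finite K]
    (T : I → J → K → F) : trank F (fun j i k => T i j k) ≤ trank F T := by
  obtain ⟨a, b, c, h⟩ := exists_trank_decomposition T
  simpa using trank_le_card (T := fun j i k => T i j k) b a c fun j i k => by
    simp only [h, mul_comm (b _ j)]

theorem trank_cycle {F I J K : Type*} [Field F] [Finite I] [Finite J] [Finite K]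
    (T : I → J → K → F) : trank F (fun k i j => T i j k) ≤ trank F T := by
  obtain ⟨a, b, c, h⟩ := exists_trank_decomposition T
  simpa using trank_le_card (T := fun k i j => T i j k) c a b fun k i j => by
    simp only [h, mul_comm _ (c _ k), mul_assoc]

theorem trank_restrict {F I J K I' J' K' : Type*} [Field F] [Finite I] [Finite J] [Finite K]
    (T : I → J → K → F) (u : I' → I) (v : J' → J) (w : K' → K) :
    trank F (fun i j k => T (u i) (v j) (w k)) ≤ trank F T := by
  obtain ⟨a, b, c, h⟩ := exists_trank_decomposition T
  simpa using trank_le_card (T := fun i j k => T (u i) (v j) (w k))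
    (fun t => a t ∘ u) (fun t => b t ∘ v) (fun t => c t ∘ w) fun i j k => h _ _ _

/-- The substitution method: the 1-slices indexed by `M` can be eliminated by subtracting
combinations of them from the other slices, lowering the rank by the dimension of their span. -/
theorem exists_trank_substitution {F I J K M J' K' : Type*} [Field F] [Finite I] [Finite J]
    [Finite K] [Finite J'] [Finite K'] [Fintype M] (X : I ⊕ M → J → K → F) (A : M → Matrix J' K' F)
    (u : J' → J) (v : K' → K) (hA : ∀ m j k, A m j k = X (Sum.inr m) (u j) (v k)) :
    ∃ c : I → M → F,
      trank F (fun i j k => X (Sum.inl i) j k + ∑ m, c i m * X (Sum.inr m) j k)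
        + Module.finrank F (Submodule.span F (Set.range A)) ≤ trank F X := by
  obtain ⟨a, b, d, h⟩ := exists_trank_decomposition X
  let w : Fin (trank F X) → J → K → F := fun t j k => b t j * d t k
  have hX : ∀ i, X i ∈ Submodule.span F (Set.range w) := fun i =>
    (Submodule.mem_span_range_iff_exists_fun F).2 ⟨fun t => a t i, by
      ext j k
      simp [h, w, Finset.sum_apply, mul_assoc]⟩
  let P := Submodule.span F (Set.range fun m => X (Sum.inr m))
  have hP : P ≤ Submodule.span F (Set.range w) :=
    Submodule.span_le.2 (by rintro _ ⟨m, rfl⟩; exact hX _)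
  obtain ⟨n, τ, hn, hτ⟩ := exists_subfamily_span_mod w P hP
  choose p hp e he using fun i => hτ _ (hX (Sum.inl i))
  choose q hq using fun i => (Submodule.mem_span_range_iff_exists_fun F).1 (hp i)
  let L : (J → K → F) →ₗ[F] Matrix J' K' F :=
    { toFun := fun Y => Matrix.of fun j k => Y (u j) (v k)
      map_add' := fun _ _ => rfl
      map_smul' := fun _ _ => rfl }
  have hL : Submodule.span F (Set.range A) = P.map L := by
    rw [Submodule.map_span, ← Set.range_comp]
    congr 2
    ext m j k
    exact hA m j k
  have hrk : Module.finrank F (Submodule.span F (Set.range A)) ≤ Module.finrank F P := by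
    rw [hL]
    have := Submodule.finiteDimensional_of_le hP
    exact Submodule.finrank_map_le L P
  refine ⟨fun i m => -q i m, ?_⟩
  have hle := trank_le_card
    (T := fun i j k => X (Sum.inl i) j k + ∑ m, -q i m * X (Sum.inr m) j k)
    (fun t i => e i t) (fun t => b (τ t)) (fun t => d (τ t)) fun i j k => by
      have h1 := congrFun (congrFun (he i) j) k
      rw [← hq i] at h1
      simp only [Pi.add_apply, Finset.sum_apply, Pi.smul_apply, smul_eq_mul, w] at h1
      rw [h1]
      simp [mul_assoc]
  simp only [Fintype.card_fin] at hle hn ⊢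
  omega

theorem Matrix.exists_eq_mul_of_rank_eq_one {F J K : Type*} [Field F] [Fintype K] [Finite J]
    {A : Matrix J K F} (hA : A.rank = 1) :
    ∃ (u : J → F) (w : K → F), ∀ j k, A j k = u j * w k := by
  rw [Matrix.rank_eq_finrank_span_cols] at hA
  obtain ⟨u, -, hu⟩ := finrank_eq_one_iff'.1 hA
  choose w hw using fun k => hu ⟨A.col k, Submodule.subset_span ⟨k, rfl⟩⟩
  refine ⟨u, w, fun j k => ?_⟩
  have := congrFun (congrArg Subtype.val (hw k)) j
  simpa [mul_comm] using this.symm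

theorem exists_rank_one_spanning_family {F J K M : Type*} [Field F] [Fintype K] [Finite J]
    [Finite M] (A : M → Matrix J K F) (hA : ∀ m, (A m).rank = 1) {d : ℕ}
    (hd : d = Module.finrank F (Submodule.span F (Set.range A))) :
    ∃ (u : Fin d → J → F) (w : Fin d → K → F), ∀ B ∈ Submodule.span F (Set.range A),
      ∃ c : Fin d → F, ∀ j k, B j k = ∑ t, c t * u t j * w t k := by
  subst hd
  obtain ⟨f, hf, hspan, -⟩ := Submodule.exists_fun_fin_finrank_span_eq F (Set.range A)
  choose τ hτ using hf
  choose u w huw using fun m => Matrix.exists_eq_mul_of_rank_eq_one (hA m)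
  refine ⟨fun t => u (τ t), fun t => w (τ t), fun B hB => ?_⟩
  rw [← hspan] at hB
  obtain ⟨c, rfl⟩ := (Submodule.mem_span_range_iff_exists_fun F).1 hB
  refine ⟨c, fun j k => ?_⟩
  simp [Matrix.sum_apply, ← hτ, huw, mul_assoc]

theorem sInf_trank_modSet_add_finrank_le {F I J K M1 M2 M3 : Type*} [Field F]
    [Finite I] [Finite J] [Finite K] [Finite M1] [Finite M2] [Finite M3]
    (T : I → J → K → F) (A1 : M1 → Matrix J K F) (A2 : M2 → Matrix I K F)
    (A3 : M3 → Matrix I J F) :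
    sInf {r | ∃ T' ∈ modSet T (Submodule.span F (Set.range A1)) (Submodule.span F (Set.range A2))
        (Submodule.span F (Set.range A3)), trank F T' = r}
        + Module.finrank F (Submodule.span F (Set.range A1))
        + Module.finrank F (Submodule.span F (Set.range A2))
        + Module.finrank F (Submodule.span F (Set.range A3))
      ≤ trank F (adjoinT T A1 A2 A3) := by
  have := Fintype.ofFinite M1
  have := Fintype.ofFinite M2
  have := Fintype.ofFinite M3
  obtain ⟨c1, h1⟩ := exists_trank_substitution (adjoinT T A1 A2 A3) A1 Sum.inl Sum.inl
    fun _ _ _ => rfl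
  set X1 : I → J ⊕ M2 → K ⊕ M3 → F := fun i j k => adjoinT T A1 A2 A3 (Sum.inl i) j k
    + ∑ m, c1 i m * adjoinT T A1 A2 A3 (Sum.inr m) j k with hX1
  obtain ⟨c2, h2⟩ := exists_trank_substitution (fun j i k => X1 i j k) A2 id Sum.inl
    fun m i k => by simp [hX1, adjoinT]
  set X2 : J → I → K ⊕ M3 → F := fun j i k => X1 i (Sum.inl j) k
    + ∑ m, c2 j m * X1 i (Sum.inr m) k with hX2
  obtain ⟨c3, h3⟩ := exists_trank_substitution (fun k i j => X2 j i k) A3 id id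
    fun m i j => by simp [hX2, hX1, adjoinT]
  set X3 : K → I → J → F := fun k i j => X2 j i (Sum.inl k)
    + ∑ m, c3 k m * X2 j i (Sum.inr m) with hX3
  have h4 := trank_swap X1
  have h5 := (trank_cycle fun i j k => X2 j i k).trans (trank_swap X2)
  have h6 := (trank_cycle fun j k i => X3 k i j).trans (trank_cycle X3)
  have h7 : sInf {r | ∃ T' ∈ modSet T (Submodule.span F (Set.range A1))
      (Submodule.span F (Set.range A2)) (Submodule.span F (Set.range A3)), trank F T' = r}
      ≤ trank F (fun i j k => X3 k i j) := by
    refine Nat.sInf_le ⟨_, ⟨fun i => ∑ m, c1 i m • A1 m, fun i => ?_,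
      fun j => ∑ m, c2 j m • A2 m, fun j => ?_, fun k => ∑ m, c3 k m • A3 m, fun k => ?_,
      fun i j k => ?_⟩, rfl⟩
    · exact (Submodule.mem_span_range_iff_exists_fun F).2 ⟨_, rfl⟩
    · exact (Submodule.mem_span_range_iff_exists_fun F).2 ⟨_, rfl⟩
    · exact (Submodule.mem_span_range_iff_exists_fun F).2 ⟨_, rfl⟩
    · simp [hX3, hX2, hX1, adjoinT, Matrix.sum_apply]
  omega

theorem trank_adjoinT_le_of_rank_eq_one {F I J K M1 M2 M3 : Type*} [Field F]
    [Fintype I] [Fintype J] [Fintype K] [Finite M1] [Finite M2] [Finite M3]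
    (T : I → J → K → F) (A1 : M1 → Matrix J K F) (A2 : M2 → Matrix I K F)
    (A3 : M3 → Matrix I J F) (hA1 : ∀ m, (A1 m).rank = 1) (hA2 : ∀ m, (A2 m).rank = 1)
    (hA3 : ∀ m, (A3 m).rank = 1) {T' : I → J → K → F}
    (hT' : T' ∈ modSet T (Submodule.span F (Set.range A1)) (Submodule.span F (Set.range A2))
      (Submodule.span F (Set.range A3))) :
    trank F (adjoinT T A1 A2 A3) ≤ trank F T'
      + Module.finrank F (Submodule.span F (Set.range A1))
      + Module.finrank F (Submodule.span F (Set.range A2))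
      + Module.finrank F (Submodule.span F (Set.range A3)) := by
  obtain ⟨f, hf, g, hg, h, hh, hfgh⟩ := hT'
  obtain ⟨a, b, c, habc⟩ := exists_trank_decomposition T'
  obtain ⟨u1, w1, h1⟩ := exists_rank_one_spanning_family A1 hA1 rfl
  obtain ⟨u2, w2, h2⟩ := exists_rank_one_spanning_family A2 hA2 rfl
  obtain ⟨u3, w3, h3⟩ := exists_rank_one_spanning_family A3 hA3 rfl
  choose p1 hp1 using fun i => h1 _ (hf i)
  choose p2 hp2 using fun j => h2 _ (hg j)
  choose p3 hp3 using fun k => h3 _ (hh k)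
  choose q1 hq1 using fun m => h1 _ (Submodule.subset_span ⟨m, rfl⟩)
  choose q2 hq2 using fun m => h2 _ (Submodule.subset_span ⟨m, rfl⟩)
  choose q3 hq3 using fun m => h3 _ (Submodule.subset_span ⟨m, rfl⟩)
  have hT : ∀ i j k, T i j k = T' i j k - f i j k - g j i k - h k i j := fun i j k => by
    rw [hfgh]; ring
  have hp2' : ∀ j i k, g j i k = ∑ t, u2 t i * p2 j t * w2 t k := by
    simpa only [mul_comm (p2 _ _)] using hp2
  have hq2' : ∀ m i k, A2 m i k = ∑ t, u2 t i * q2 m t * w2 t k := by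
    simpa only [mul_comm (q2 _ _)] using hq2
  have hp3' : ∀ k i j, h k i j = ∑ t, u3 t i * w3 t j * p3 k t := by
    simpa only [mul_assoc, mul_comm (p3 _ _)] using hp3
  have hq3' : ∀ m i j, A3 m i j = ∑ t, u3 t i * w3 t j * q3 m t := by
    simpa only [mul_assoc, mul_comm (q3 _ _)] using hq3
  have hle := trank_le_card (T := adjoinT T A1 A2 A3)
    (Sum.elim (fun t => Sum.elim (a t) 0) <|
      Sum.elim (fun t => Sum.elim (fun i => -p1 i t) fun m => q1 m t) <|
      Sum.elim (fun t => Sum.elim (u2 t) 0) fun t => Sum.elim (u3 t) 0)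
    (Sum.elim (fun t => Sum.elim (b t) 0) <|
      Sum.elim (fun t => Sum.elim (u1 t) 0) <|
      Sum.elim (fun t => Sum.elim (fun j => -p2 j t) fun m => q2 m t)
        fun t => Sum.elim (w3 t) 0)
    (Sum.elim (fun t => Sum.elim (c t) 0) <|
      Sum.elim (fun t => Sum.elim (w1 t) 0) <|
      Sum.elim (fun t => Sum.elim (w2 t) 0)
        fun t => Sum.elim (fun k => -p3 k t) fun m => q3 m t) fun i j k => by
      rcases i with i | i <;> rcases j with j | j <;> rcases k with k | k <;>
        simp [adjoinT, hT, habc, hp1, hp2', hp3', hq1, hq2', hq3', Fintype.sum_sum_type]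
      ring
  simp only [Fintype.card_sum, Fintype.card_fin] at hle
  omega

/-- Adjoining slices spanning `V1`, `V2`, `V3` to `T` gives a tensor of rank at least
`min rank (T mod (V1,V2,V3)) + dim V1 + dim V2 + dim V3`, with equality when all the
adjoined matrices have rank one. -/
theorem trank_adjoin {F I J K M1 M2 M3 : Type*} [Field F]
    [Fintype I] [Fintype J] [Fintype K] [Fintype M1] [Fintype M2] [Fintype M3]
    [DecidableEq I] [DecidableEq J] [DecidableEq K]
    (T : I → J → K → F) (A1 : M1 → Matrix J K F) (A2 : M2 → Matrix I K F)
    (A3 : M3 → Matrix I J F)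
    (V1 : Submodule F (Matrix J K F)) (hV1 : V1 = Submodule.span F (Set.range A1))
    (V2 : Submodule F (Matrix I K F)) (hV2 : V2 = Submodule.span F (Set.range A2))
    (V3 : Submodule F (Matrix I J F)) (hV3 : V3 = Submodule.span F (Set.range A3)) :
    (sInf {r | ∃ T' ∈ modSet T V1 V2 V3, trank F T' = r}
        + Module.finrank F V1 + Module.finrank F V2 + Module.finrank F V3
      ≤ trank F (adjoinT T A1 A2 A3)) ∧
    ((∀ m, (A1 m).rank = 1) → (∀ m, (A2 m).rank = 1) → (∀ m, (A3 m).rank = 1) →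
      trank F (adjoinT T A1 A2 A3)
        = sInf {r | ∃ T' ∈ modSet T V1 V2 V3, trank F T' = r}
          + Module.finrank F V1 + Module.finrank F V2 + Module.finrank F V3) := by
  subst hV1 hV2 hV3
  have hlower := sInf_trank_modSet_add_finrank_le T A1 A2 A3
  refine ⟨hlower, fun h1 h2 h3 => le_antisymm ?_ hlower⟩
  obtain ⟨T', hT', hr⟩ := Nat.sInf_mem (s := {r | ∃ T' ∈ modSet T
    (Submodule.span F (Set.range A1)) (Submodule.span F (Set.range A2))
    (Submodule.span F (Set.range A3)), trank F T' = r})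
    ⟨_, T, ⟨0, fun _ => zero_mem _, 0, fun _ => zero_mem _, 0, fun _ => zero_mem _,
      fun i j k => by simp⟩, rfl⟩
  rw [← hr]
  exact trank_adjoinT_le_of_rank_eq_one T A1 A2 A3 h1 h2 h3 hT'
end
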